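/- arXiv:1812.11540 — 5 statements merged into one kernel-verified Lean document; each statement's English description precedes it below -/
import Mathlib

section
/- Let t be an irrational algebraic real number and fix any r > 0. Then there exists a constant C > 0 (depending on t and r) such that for all integers p and all nonzero integers q one has |t − p/q| > C/|q|^{2+r}. -/
namespace RothTheorem

open MvPolynomial

section Hasse

variable {σ R S : Type*} [Fintype σ] [CommRing R] [CommRing S]

/-- The product of the binomial coefficients of two multi-indices. -/
def multichoose (ν μ : σ →₀ ℕ) : ℕ := ∏ i, (ν i).choose (μ i)

lemma multichoose_eq_zero {ν μ : σ →₀ ℕ} (h : ¬ μ ≤ ν) : multichoose ν μ = 0 := by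
  simp only [Finsupp.le_def, not_forall, not_le] at h
  obtain ⟨i, hi⟩ := h
  exact Finset.prod_eq_zero (Finset.mem_univ i) (Nat.choose_eq_zero_of_lt hi)

lemma multichoose_le (ν μ : σ →₀ ℕ) : multichoose ν μ ≤ 2 ^ ∑ i, ν i := by
  rw [← Finset.prod_pow_eq_pow_sum]
  exact Finset.prod_le_prod' fun i _ => Nat.choose_le_two_pow _ _

lemma multichoose_mul (ν μ κ : σ →₀ ℕ) :
    multichoose ν μ * multichoose (ν - μ) κ =
      multichoose (μ + κ) μ * multichoose ν (μ + κ) := by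
  simp only [multichoose, ← Finset.prod_mul_distrib]
  refine Finset.prod_congr rfl fun i _ => ?_
  have := @Nat.choose_mul (ν i) (μ i + κ i) (μ i) (by omega)
  simp only [Finsupp.tsub_apply, Finsupp.add_apply]
  rw [mul_comm ((μ i + κ i).choose _), this]
  simp

/-- The Hasse derivative (divided partial derivative) with multi-index `μ`. -/
noncomputable def hasse (μ : σ →₀ ℕ) : MvPolynomial σ R →ₗ[R] MvPolynomial σ R :=
  (basisMonomials σ R).constr R fun ν => monomial (ν - μ) (multichoose ν μ : R)

lemma hasse_monomial (μ ν : σ →₀ ℕ) (c : R) :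
    hasse μ (monomial ν c) = monomial (ν - μ) (c * multichoose ν μ) := by
  have h : (monomial ν c : MvPolynomial σ R) = c • basisMonomials σ R ν := by
    simp [smul_monomial]
  rw [h, map_smul, hasse, Module.Basis.constr_basis, smul_monomial, smul_eq_mul]

lemma map_hasse (f : R →+* S) (μ : σ →₀ ℕ) (P : MvPolynomial σ R) :
    map f (hasse μ P) = hasse μ (map f P) := by
  induction P using MvPolynomial.induction_on' with
  | monomial ν c => simp [hasse_monomial, map_monomial]
  | add p q hp hq => simp [hp, hq]

lemma hasse_hasse (μ κ : σ →₀ ℕ) (P : MvPolynomial σ R) :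
    hasse κ (hasse μ P) = (multichoose (μ + κ) μ : R) • hasse (μ + κ) P := by
  induction P using MvPolynomial.induction_on' with
  | monomial ν c =>
    simp only [hasse_monomial, smul_monomial, tsub_add_eq_tsub_tsub, smul_eq_mul]
    congr 1
    have := congrArg (Nat.cast (R := R)) (multichoose_mul ν μ κ)
    push_cast at this
    rw [mul_assoc, this]
    ring
  | add p q hp hq => simp [hp, hq]

lemma degreeOf_hasse_le (μ : σ →₀ ℕ) (P : MvPolynomial σ R) (i : σ) :
    degreeOf i (hasse μ P) ≤ degreeOf i P := by
  conv_lhs => rw [P.as_sum, map_sum]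
  refine (degreeOf_sum_le _ _ _).trans (Finset.sup_le fun ν hν => ?_)
  rw [hasse_monomial, degreeOf_le_iff]
  intro m hm
  have : m = ν - μ := by simpa using support_monomial_subset hm
  rw [this]
  exact (Nat.sub_le _ _).trans (degreeOf_le_iff.mp le_rfl ν hν)

/-- The substitution `x ↦ x + b`. -/
noncomputable def translate (b : σ → R) : MvPolynomial σ R →ₐ[R] MvPolynomial σ R :=
  aeval fun i => X i + C (b i)

lemma coeff_translate (b : σ → R) (P : MvPolynomial σ R) (μ : σ →₀ ℕ) :
    coeff μ (translate b P) = eval b (hasse μ P) := by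
  classical
  induction P using MvPolynomial.induction_on' with
  | monomial ν c =>
    have key : translate b (monomial ν c) =
        ∑ f ∈ Fintype.piFinset fun i => Finset.range (ν i + 1),
          monomial (Finsupp.equivFunOnFinite.symm f)
            (c * ∏ i, (b i ^ (ν i - f i) * ((ν i).choose (f i) : R))) := by
      rw [translate, aeval_monomial, Finsupp.prod_fintype _ _ (by simp)]
      simp only [add_pow]
      rw [Finset.prod_univ_sum, Finset.mul_sum]
      refine Finset.sum_congr rfl fun f _ => ?_
      rw [monomial_eq, Finsupp.prod_fintype _ _ (by simp)]
      simp only [Finset.prod_mul_distrib, map_mul, map_prod, map_pow, map_natCast,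
        MvPolynomial.algebraMap_eq, Finsupp.equivFunOnFinite_symm_apply_apply]
      ring
    rw [key, coeff_sum, hasse_monomial, eval_monomial, Finsupp.prod_fintype _ _ (by simp)]
    simp only [coeff_monomial]
    by_cases h : μ ≤ ν
    · rw [Finset.sum_eq_single (μ : σ → ℕ)]
      · rw [if_pos (by ext; simp)]
        simp only [multichoose, Finset.prod_mul_distrib, Nat.cast_prod, Finsupp.tsub_apply]
        ring
      · intro f _ hf
        rw [if_neg]
        rintro rfl
        exact hf (by ext; simp)
      · intro hn
        exact absurd (by simpa [Nat.lt_succ_iff] using fun i => h i) hn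
    · rw [multichoose_eq_zero h, Finset.sum_eq_zero]
      · simp
      · intro f hf
        rw [if_neg]
        rintro rfl
        exact h fun i => by simpa [Nat.lt_succ_iff] using Fintype.mem_piFinset.mp hf i
  | add p q hp hq => simp [hp, hq]

end Hasse

lemma eval_translate {σ R : Type*} [CommRing R] (b x : σ → R) (P : MvPolynomial σ R) :
    eval x (translate b P) = eval (x + b) P := by
  induction P using MvPolynomial.induction_on with
  | C a => simp [translate]
  | add p q hp hq => simp [hp, hq]
  | mul_X p i hp =>
    rw [map_mul, map_mul, hp, map_mul]
    simp [translate]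

section Length

variable {σ : Type*}

/-- The length of an integer polynomial: the sum of the absolute values of its coefficients. -/
noncomputable def length (P : MvPolynomial σ ℤ) : ℤ := ∑ ν ∈ P.support, |coeff ν P|

lemma length_eq_of_subset {P : MvPolynomial σ ℤ} {s : Finset (σ →₀ ℕ)} (h : P.support ⊆ s) :
    length P = ∑ ν ∈ s, |coeff ν P| :=
  Finset.sum_subset h fun ν _ hν => by simpa using hν

lemma length_nonneg (P : MvPolynomial σ ℤ) : 0 ≤ length P :=
  Finset.sum_nonneg fun _ _ => abs_nonneg _

lemma sum_abs_coeff_le_length (P : MvPolynomial σ ℤ) (s : Finset (σ →₀ ℕ)) :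
    ∑ ν ∈ s, |coeff ν P| ≤ length P := by
  classical
  rw [length_eq_of_subset (Finset.subset_union_left (s₂ := s))]
  exact Finset.sum_le_sum_of_subset_of_nonneg Finset.subset_union_right
    fun _ _ _ => abs_nonneg _

lemma abs_coeff_le_length (P : MvPolynomial σ ℤ) (ν : σ →₀ ℕ) : |coeff ν P| ≤ length P := by
  simpa using sum_abs_coeff_le_length P {ν}

lemma one_le_length {P : MvPolynomial σ ℤ} (h : P ≠ 0) : 1 ≤ length P := by
  obtain ⟨ν, hν⟩ := ne_zero_iff.mp h
  exact (Int.one_le_abs hν).trans (abs_coeff_le_length P ν)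

lemma length_zero : length (0 : MvPolynomial σ ℤ) = 0 := by simp [length]

lemma length_add_le (P Q : MvPolynomial σ ℤ) : length (P + Q) ≤ length P + length Q := by
  classical
  rw [length_eq_of_subset (s := P.support ∪ Q.support) support_add,
    length_eq_of_subset (Finset.subset_union_left (s₂ := Q.support)),
    length_eq_of_subset (P := Q) (Finset.subset_union_right (s₁ := P.support)),
    ← Finset.sum_add_distrib]
  exact Finset.sum_le_sum fun ν _ => by simpa using abs_add_le _ _

lemma length_sum_le {ι : Type*} (s : Finset ι) (f : ι → MvPolynomial σ ℤ) :
    length (∑ i ∈ s, f i) ≤ ∑ i ∈ s, length (f i) :=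
  Finset.le_sum_of_subadditive _ length_zero.le length_add_le _ _

lemma length_monomial (ν : σ →₀ ℕ) (c : ℤ) : length (monomial ν c) = |c| := by
  classical
  rw [length_eq_of_subset support_monomial_subset]
  simp

lemma length_mul_le (P Q : MvPolynomial σ ℤ) : length (P * Q) ≤ length P * length Q := by
  conv_lhs => rw [P.as_sum, Q.as_sum, Finset.sum_mul_sum]
  refine (length_sum_le _ _).trans ?_
  rw [length, length, Finset.sum_mul_sum]
  refine Finset.sum_le_sum fun μ _ => (length_sum_le _ _).trans ?_
  exact Finset.sum_le_sum fun ν _ => by rw [monomial_mul, length_monomial, abs_mul]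

lemma length_prod_le {ι : Type*} (s : Finset ι) (f : ι → MvPolynomial σ ℤ) :
    length (∏ i ∈ s, f i) ≤ ∏ i ∈ s, length (f i) := by
  classical
  induction s using Finset.induction_on with
  | empty => simpa using (length_monomial (0 : σ →₀ ℕ) 1).le
  | insert a s ha ih =>
    rw [Finset.prod_insert ha, Finset.prod_insert ha]
    exact (length_mul_le _ _).trans (mul_le_mul_of_nonneg_left ih (length_nonneg _))

lemma length_det_le {k : ℕ} (M : Matrix (Fin k) (Fin k) (MvPolynomial σ ℤ)) {B : ℤ}
    (hM : ∀ i j, length (M i j) ≤ B) : length M.det ≤ k.factorial * B ^ k := by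
  rw [Matrix.det_apply]
  refine (length_sum_le _ _).trans ?_
  have h : ∀ τ ∈ (Finset.univ : Finset (Equiv.Perm (Fin k))),
      length (Equiv.Perm.sign τ • ∏ i, M (τ i) i) ≤ B ^ k := by
    intro τ _
    have h1 : length (∏ i, M (τ i) i) ≤ B ^ k := by
      refine (length_prod_le _ _).trans ?_
      refine (Finset.prod_le_prod (fun _ _ => length_nonneg _) fun i _ => hM (τ i) i).trans ?_
      simp
    rcases Int.units_eq_one_or (Equiv.Perm.sign τ) with h | h <;> rw [h]
    · simpa using h1
    · simpa [length] using h1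
  refine (Finset.sum_le_sum h).trans ?_
  simp [Fintype.card_perm]

lemma length_hasse_le [Fintype σ] (μ : σ →₀ ℕ) (P : MvPolynomial σ ℤ) {d : σ → ℕ}
    (hd : ∀ i, degreeOf i P ≤ d i) : length (hasse μ P) ≤ 2 ^ (∑ i, d i) * length P := by
  conv_lhs => rw [P.as_sum, map_sum]
  refine (length_sum_le _ _).trans ?_
  rw [length, Finset.mul_sum]
  refine Finset.sum_le_sum fun ν hν => ?_
  rw [hasse_monomial, length_monomial, abs_mul, mul_comm]
  refine mul_le_mul_of_nonneg_right ?_ (abs_nonneg _)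
  rw [Nat.abs_cast]
  have h1 : multichoose ν μ ≤ 2 ^ ∑ i, d i :=
    (multichoose_le ν μ).trans (Nat.pow_le_pow_right (by norm_num)
      (Finset.sum_le_sum fun i _ => (degreeOf_le_iff.mp le_rfl ν hν).trans (hd i)))
  exact_mod_cast h1

end Length

end RothTheorem

namespace RothTheorem

section Euler

open Polynomial

variable {K : Type*} [Field K]

/-- The operator `f ↦ X * f'`, for which every monomial is an eigenvector. -/
noncomputable def euler (K : Type*) [Field K] : K[X] →ₗ[K] K[X] :=
  LinearMap.mulLeft K X ∘ₗ derivative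

lemma coeff_euler_pow (i n : ℕ) (f : K[X]) :
    ((euler K ^ i) f).coeff n = (n : K) ^ i * f.coeff n := by
  induction i generalizing f with
  | zero => simp
  | succ i ih =>
    rw [pow_succ, Module.End.mul_apply, ih]
    cases n with
    | zero => simp [euler]
    | succ n => simp [euler, coeff_X_mul, coeff_derivative]; ring

lemma euler_pow_monomial (i n : ℕ) (c : K) :
    (euler K ^ i) (monomial n c) = monomial n ((n : K) ^ i * c) := by
  ext m
  rw [coeff_euler_pow, coeff_monomial, coeff_monomial]
  split_ifs with h <;> simp [h]

lemma natDegree_euler_pow_le (i : ℕ) (f : K[X]) : ((euler K ^ i) f).natDegree ≤ f.natDegree := by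
  rw [natDegree_le_iff_coeff_eq_zero]
  intro n hn
  rw [coeff_euler_pow, coeff_eq_zero_of_natDegree_lt hn, mul_zero]

lemma coeff_sum_prod_of_natDegree_le {ι : Type*} (s : Finset ι) (f : ι → K[X]) (d : ι → ℕ)
    (h : ∀ i ∈ s, (f i).natDegree ≤ d i) :
    (∏ i ∈ s, f i).coeff (∑ i ∈ s, d i) = ∏ i ∈ s, (f i).coeff (d i) := by
  classical
  induction s using Finset.induction_on with
  | empty => simp
  | insert a s ha ih =>
    have h' : ∀ i ∈ s, (f i).natDegree ≤ d i := fun i hi => h i (Finset.mem_insert_of_mem hi)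
    rw [Finset.prod_insert ha, Finset.sum_insert ha, Finset.prod_insert ha,
      coeff_mul_add_eq_of_natDegree_le (h a (Finset.mem_insert_self _ _)), ih h']
    exact (natDegree_prod_le _ _).trans (Finset.sum_le_sum h')

/-- The Wronskian matrix with respect to the Euler operator. -/
noncomputable def eulerMatrix {k : ℕ} (f : Fin k → K[X]) : Matrix (Fin k) (Fin k) K[X] :=
  Matrix.of fun i j => (euler K ^ (i : ℕ)) (f j)

lemma det_eulerMatrix_ne_zero_of_injective [CharZero K] {k : ℕ} (f : Fin k → K[X])
    (h0 : ∀ j, f j ≠ 0) (hinj : Function.Injective fun j => (f j).natDegree) :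
    (eulerMatrix f).det ≠ 0 := by
  have key : (eulerMatrix f).det.coeff (∑ j, (f j).natDegree) =
      (∏ j, (f j).leadingCoeff) *
        (Matrix.vandermonde fun j => ((f j).natDegree : K)).det := by
    rw [← Matrix.det_transpose (Matrix.vandermonde _), ← Matrix.det_mul_row, Matrix.det_apply,
      Matrix.det_apply, finsetSum_coeff]
    refine Finset.sum_congr rfl fun τ _ => ?_
    rw [coeff_smul, coeff_sum_prod_of_natDegree_le]
    · congr 1
      refine Finset.prod_congr rfl fun i _ => ?_
      simp [eulerMatrix, coeff_euler_pow, Matrix.vandermonde_apply, mul_comm]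
    · intro i _
      exact natDegree_euler_pow_le _ _
  intro h
  rw [h, coeff_zero] at key
  refine mul_ne_zero (Finset.prod_ne_zero_iff.mpr fun j _ => leadingCoeff_ne_zero.mpr (h0 j)) ?_
    key.symm
  rw [Matrix.det_vandermonde_ne_zero_iff]
  exact Nat.cast_injective.comp hinj

lemma det_eulerMatrix_ne_zero [CharZero K] {k : ℕ} (f : Fin k → K[X])
    (hf : LinearIndependent K f) : (eulerMatrix f).det ≠ 0 := by
  induction hs : ∑ j, (f j).natDegree using Nat.strong_induction_on generalizing f with
  | _ s ih =>
  by_cases hinj : Function.Injective fun j => (f j).natDegree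
  · exact det_eulerMatrix_ne_zero_of_injective f (fun j => hf.ne_zero j) hinj
  simp only [Function.Injective, not_forall] at hinj
  obtain ⟨i, j, hij, hne⟩ := hinj
  set c : K := -((f i).leadingCoeff / (f j).leadingCoeff) with hc
  have hj0 : (f j).leadingCoeff ≠ 0 := leadingCoeff_ne_zero.mpr (hf.ne_zero j)
  have hi0 : (f i).leadingCoeff ≠ 0 := leadingCoeff_ne_zero.mpr (hf.ne_zero i)
  have hc0 : c ≠ 0 := neg_ne_zero.mpr (div_ne_zero hi0 hj0)
  let g : Fin k → K[X] := Function.update f i (f i + c • f j)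
  have hg : LinearIndependent K g := by
    rw [Fintype.linearIndependent_iff] at hf ⊢
    intro a ha
    have h1 : ∑ l, (a l + if l = j then a i * c else 0) • f l = 0 := by
      rw [← ha]
      have : ∀ l, g l = f l + if l = i then c • f j else 0 := by
        intro l
        by_cases hl : l = i
        · subst hl; simp [g]
        · simp [g, hl]
      simp only [this, smul_add, add_smul, Finset.sum_add_distrib]
      simp [ite_smul, smul_ite, mul_smul]
    have h2 := hf _ h1
    have hai : a i = 0 := by simpa [hne] using h2 i
    intro l
    simpa [hai] using h2 l
  have hdeg : (g i).natDegree < (f i).natDegree := by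
    have hlt : (f i + c • f j).degree < (f i).degree := by
      have hd : (f i).degree = (-(c • f j)).degree := by
        rw [degree_neg, degree_smul_of_smul_regular _ (IsSMulRegular.of_ne_zero hc0),
          degree_eq_natDegree (hf.ne_zero i), degree_eq_natDegree (hf.ne_zero j)]
        exact_mod_cast hij
      have := degree_sub_lt_left hd (hf.ne_zero i) (by
        rw [leadingCoeff_neg, leadingCoeff_smul_of_smul_regular _ (IsSMulRegular.of_ne_zero hc0),
          hc, smul_eq_mul]
        field_simp)
      simpa using this
    have : g i = f i + c • f j := by simp [g]
    rw [this]
    exact natDegree_lt_natDegree (this ▸ hg.ne_zero i) hlt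
  have hsum : ∑ l, (g l).natDegree < s := by
    rw [← hs]
    refine Finset.sum_lt_sum (fun l _ => ?_) ⟨i, Finset.mem_univ _, hdeg⟩
    by_cases hl : l = i
    · subst hl; exact hdeg.le
    · simp [g, hl]
  have hW := ih _ hsum g hg rfl
  have : (eulerMatrix g) = (eulerMatrix f).updateCol i
      fun l => eulerMatrix f l i + (C c) • eulerMatrix f l j := by
    ext1 l m
    by_cases hm : m = i
    · subst hm; simp [g, eulerMatrix, ← smul_eq_C_mul]
    · simp [g, eulerMatrix, hm]
  rwa [this, Matrix.det_updateCol_add_smul_self _ hne] at hW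

end Euler

section Wronskian

open MvPolynomial

variable {K : Type*} [Field K] {n : ℕ}

/-- The linear form whose value on multi-indices with entries below `N` is the number with those
base `N` digits. -/
def digitForm (N : ℕ) (ν : Fin n →₀ ℕ) : ℕ := ∑ i, ν i * N ^ (i : ℕ)

lemma digitForm_injOn (N : ℕ) : Set.InjOn (digitForm (n := n) N) {ν | ∀ i, ν i < N} := by
  intro ν hν μ hμ h
  have : (fun i => (⟨ν i, hν i⟩ : Fin N)) = fun i => ⟨μ i, hμ i⟩ := by
    apply finFunctionFinEquiv.injective
    apply Fin.ext
    rw [finFunctionFinEquiv_apply, finFunctionFinEquiv_apply]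
    exact h
  ext i
  exact congrArg Fin.val (congrFun this i)

/-- The Kronecker substitution. -/
noncomputable def kronecker (K : Type*) [Field K] (n N : ℕ) :
    MvPolynomial (Fin n) K →ₐ[K] Polynomial K :=
  aeval fun i => Polynomial.X ^ (N ^ (i : ℕ))

lemma kronecker_monomial (N : ℕ) (ν : Fin n →₀ ℕ) (c : K) :
    kronecker K n N (monomial ν c) = Polynomial.monomial (digitForm N ν) c := by
  rw [kronecker, aeval_monomial, Finsupp.prod_fintype _ _ (by simp)]
  simp only [← pow_mul, Finset.prod_pow_eq_pow_sum]
  rw [← Polynomial.C_mul_X_pow_eq_monomial, Polynomial.algebraMap_eq, digitForm]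
  simp only [mul_comm]

lemma eq_zero_of_kronecker_eq_zero {N : ℕ} {P : MvPolynomial (Fin n) K}
    (hN : ∀ i, degreeOf i P < N) (hP : kronecker K n N P = 0) : P = 0 := by
  by_contra h
  obtain ⟨ν, hν⟩ := ne_zero_iff.mp h
  have hlt : ∀ κ ∈ P.support, ∀ i, κ i < N := fun κ hκ i =>
    (degreeOf_le_iff.mp le_rfl κ hκ).trans_lt (hN i)
  have h1 := congrArg (Polynomial.coeff · (digitForm N ν)) hP
  rw [P.as_sum, map_sum] at h1
  simp only [kronecker_monomial, Polynomial.finsetSum_coeff, Polynomial.coeff_monomial,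
    Polynomial.coeff_zero] at h1
  rw [Finset.sum_eq_single ν] at h1
  · exact hν (by simpa using h1)
  · intro κ hκ hne
    rw [if_neg]
    intro heq
    exact hne (digitForm_injOn N (hlt κ hκ) (hlt ν (mem_support_iff.mpr hν)) heq)
  · intro hn
    simpa using hn

/-- Powers of a linear form are combinations of products of binomial coefficients. -/
lemma digitForm_pow_mem_span (N i : ℕ) :
    (fun ν : Fin n →₀ ℕ => (digitForm N ν : K) ^ i) ∈ Submodule.span K
      ((fun μ ν => (multichoose ν μ : K)) '' {μ : Fin n →₀ ℕ | ∑ h, μ h ≤ i}) := by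
  classical
  induction i with
  | zero =>
    refine Submodule.subset_span ⟨0, by simp, ?_⟩
    ext ν
    simp [multichoose]
  | succ i ih =>
    let m : (((Fin n →₀ ℕ) → K)) →ₗ[K] ((Fin n →₀ ℕ) → K) :=
      LinearMap.mulLeft K fun ν : Fin n →₀ ℕ => (digitForm N ν : K)
    have h1 : (fun ν : Fin n →₀ ℕ => (digitForm N ν : K) ^ (i + 1)) =
        m fun ν => (digitForm N ν : K) ^ i := by
      ext ν
      simp [m, pow_succ']
    rw [h1]
    refine Submodule.span_induction (p := fun x _ => m x ∈ Submodule.span K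
      ((fun μ ν => (multichoose ν μ : K)) '' {μ : Fin n →₀ ℕ | ∑ h, μ h ≤ i + 1}))
      ?_ ?_ ?_ ?_ ih
    · rintro _ ⟨μ, hμ, rfl⟩
      have h2 : (m fun ν => (multichoose ν μ : K)) = ∑ h : Fin n, ((N : K) ^ (h : ℕ)) •
          ((((μ h + 1 : ℕ) : K) • fun ν => (multichoose ν (μ + Finsupp.single h 1) : K)) +
            ((μ h : K) • fun ν => (multichoose ν μ : K))) := by
        ext ν
        simp only [m, LinearMap.mulLeft_apply, Pi.mul_apply, digitForm, Nat.cast_sum,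
          Finset.sum_mul, Finset.sum_apply, Pi.smul_apply, Pi.add_apply, smul_eq_mul]
        refine Finset.sum_congr rfl fun h _ => ?_
        have h3 : ν h * multichoose ν μ =
            (μ h + 1) * multichoose ν (μ + Finsupp.single h 1) + μ h * multichoose ν μ := by
          have e1 : multichoose ν μ = (ν h).choose (μ h) *
              ∏ l ∈ Finset.univ.erase h, (ν l).choose (μ l) :=
            (Finset.mul_prod_erase _ _ (Finset.mem_univ h)).symm
          have e2 : multichoose ν (μ + Finsupp.single h 1) = (ν h).choose (μ h + 1) *
              ∏ l ∈ Finset.univ.erase h, (ν l).choose (μ l) := by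
            rw [multichoose, ← Finset.mul_prod_erase _ _ (Finset.mem_univ h)]
            congr 1
            · simp
            · refine Finset.prod_congr rfl fun l hl => ?_
              rw [Finset.mem_erase] at hl
              simp [hl.1.symm]
          rw [e1, e2]
          have e3 : ν h * (ν h).choose (μ h) =
              (μ h + 1) * (ν h).choose (μ h + 1) + μ h * (ν h).choose (μ h) := by
            rcases le_or_gt (μ h) (ν h) with hle | hlt
            · have := Nat.choose_succ_right_eq (ν h) (μ h)
              obtain ⟨t, ht⟩ := Nat.exists_eq_add_of_le hle
              rw [ht] at this ⊢
              simp only [Nat.add_sub_cancel_left] at this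
              rw [mul_comm (μ h + 1), this]
              ring
            · simp [Nat.choose_eq_zero_of_lt hlt, Nat.choose_eq_zero_of_lt (Nat.lt_succ_of_lt hlt)]
          rw [← mul_assoc, e3]
          ring
        have h4 := congrArg (Nat.cast (R := K)) h3
        push_cast at h4 ⊢
        linear_combination (N : K) ^ (h : ℕ) * h4
      rw [h2]
      refine Submodule.sum_mem _ fun h _ => Submodule.smul_mem _ _ (Submodule.add_mem _
        (Submodule.smul_mem _ _ (Submodule.subset_span ⟨_, ?_, rfl⟩))
        (Submodule.smul_mem _ _ (Submodule.subset_span ⟨_, ?_, rfl⟩)))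
      · simp only [Set.mem_ofPred_eq, Finsupp.add_apply, Finset.sum_add_distrib] at hμ ⊢
        have : ∑ l, (Finsupp.single h 1 : Fin n →₀ ℕ) l = 1 := by
          simp [Finsupp.single_apply]
        omega
      · simp only [Set.mem_ofPred_eq] at hμ ⊢
        omega
    · simp
    · intro x y _ _ hx hy
      rw [map_add]
      exact Submodule.add_mem _ hx hy
    · intro a x _ hx
      rw [map_smul]
      exact Submodule.smul_mem _ _ hx

lemma monomial_mul_hasse_monomial (μ ν : Fin n →₀ ℕ) (c : K) :
    monomial μ 1 * hasse μ (monomial ν c) = monomial ν (c * multichoose ν μ) := by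
  rw [hasse_monomial, monomial_mul, one_mul]
  by_cases h : μ ≤ ν
  · rw [add_tsub_cancel_of_le h]
  · simp [multichoose_eq_zero h]

/-- A generalized Wronskian of linearly independent polynomials does not vanish. -/
theorem exists_det_hasse_ne_zero [CharZero K] {k : ℕ} (φ : Fin k → MvPolynomial (Fin n) K)
    (hφ : LinearIndependent K φ) :
    ∃ μ : Fin k → (Fin n →₀ ℕ), (∀ i, ∑ h, μ i h ≤ i) ∧
      (Matrix.of fun i j => hasse (μ i) (φ j)).det ≠ 0 := by
  classical
  obtain ⟨N, hN0, hN⟩ : ∃ N : ℕ, 0 < N ∧ ∀ j i, degreeOf i (φ j) < N := by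
    refine ⟨(∑ j, ∑ i, degreeOf i (φ j)) + 1, Nat.succ_pos _, fun j i => Nat.lt_succ_of_le ?_⟩
    exact (Finset.single_le_sum (f := fun i => degreeOf i (φ j)) (fun _ _ => Nat.zero_le _)
      (Finset.mem_univ i)).trans (Finset.single_le_sum
      (f := fun j => ∑ i, degreeOf i (φ j)) (fun _ _ => Nat.zero_le _) (Finset.mem_univ j))
  have hind : LinearIndependent K fun j => kronecker K n N (φ j) := by
    rw [Fintype.linearIndependent_iff] at hφ ⊢
    intro a ha
    refine hφ a (eq_zero_of_kronecker_eq_zero (N := N) (fun i => ?_) ?_)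
    · rw [Nat.lt_iff_le_pred hN0]
      refine (degreeOf_sum_le _ _ _).trans (Finset.sup_le fun l _ => ?_)
      rw [smul_eq_C_mul]
      exact (degreeOf_C_mul_le _ _ _).trans (Nat.le_pred_of_lt (hN l i))
    · simpa using ha
  have hdet := det_eulerMatrix_ne_zero _ hind
  choose s hs c hc using fun i : Fin k => (Submodule.mem_span_image_iff_exists_fun K).mp
    (digitForm_pow_mem_span (K := K) (n := n) N i)
  have hrow : ∀ i j : Fin k, (euler K ^ (i : ℕ)) (kronecker K n N (φ j)) =
      ∑ μ : s i, kronecker K n N (C (c i μ) * monomial μ.1 1) *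
        kronecker K n N (hasse μ.1 (φ j)) := by
    intro i j
    simp only [← map_mul, ← map_sum]
    induction φ j using MvPolynomial.induction_on' with
    | monomial ν b =>
      simp only [mul_assoc, monomial_mul_hasse_monomial]
      simp only [C_mul_monomial, ← map_sum]
      rw [kronecker_monomial, kronecker_monomial, euler_pow_monomial]
      congr 1
      have := congrFun (hc i) ν
      simp only [Finset.sum_apply, Pi.smul_apply, smul_eq_mul] at this
      rw [← this, Finset.sum_mul]
      exact Finset.sum_congr rfl fun _ _ => by ring
    | add p q hp hq => simp only [map_add, mul_add, Finset.sum_add_distrib, hp, hq]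
  have hexp : (eulerMatrix fun j => kronecker K n N (φ j)).det =
      Matrix.detRowAlternating (R := Polynomial K) (n := Fin k) fun i =>
        ∑ μ : s i, kronecker K n N (C (c i μ) * monomial μ.1 1) •
          fun j => kronecker K n N (hasse μ.1 (φ j)) := by
    show Matrix.det _ = Matrix.det _
    congr 1
    ext1 i j
    simp [eulerMatrix, hrow]
  rw [hexp] at hdet
  erw [MultilinearMap.map_sum_finset] at hdet
  obtain ⟨r, -, hr⟩ := Finset.exists_ne_zero_of_sum_ne_zero hdet
  erw [MultilinearMap.map_smul_univ] at hr
  refine ⟨fun i => (r i).1, fun i => hs i (r i).2, fun h0 => hr ?_⟩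
  have h1 : Matrix.det (Matrix.of fun i j => kronecker K n N (hasse (r i).1 (φ j))) = 0 := by
    have := congrArg (kronecker K n N) h0
    rw [AlgHom.map_det, map_zero] at this
    exact this
  exact (congrArg _ h1).trans (smul_zero _)

end Wronskian

end RothTheorem

namespace RothTheorem

open MvPolynomial

section Tensor

variable {K : Type*} [Field K] {n : ℕ}

theorem exists_det_hasseDeriv_ne_zero [CharZero K] {k : ℕ} (ψ : Fin k → Polynomial K)
    (hψ : LinearIndependent K ψ) :
    ∃ b : Fin k → ℕ, (∀ i, b i ≤ i) ∧
      (Matrix.of fun i j => Polynomial.hasseDeriv (b i) (ψ j)).det ≠ 0 := by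
  let e := uniqueAlgEquiv K (Fin 1)
  have he : ∀ (μ : Fin 1 →₀ ℕ) (P : MvPolynomial (Fin 1) K),
      e (hasse μ P) = Polynomial.hasseDeriv (μ 0) (e P) := by
    intro μ P
    induction P using MvPolynomial.induction_on' with
    | monomial ν c =>
      simp only [e, hasse_monomial, uniqueAlgEquiv_monomial, Polynomial.hasseDeriv_monomial]
      simp [multichoose, mul_comm]
    | add p q hp hq => simp [hp, hq]
  obtain ⟨μ, hμ, hdet⟩ := exists_det_hasse_ne_zero (fun j => e.symm (ψ j))
    (hψ.map' e.symm.toLinearMap (LinearMap.ker_eq_bot.mpr e.symm.injective))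
  refine ⟨fun i => μ i 0, fun i => by simpa using hμ i, fun h0 => hdet ?_⟩
  apply e.injective
  rw [map_zero, AlgEquiv.map_det, ← h0]
  congr 1
  ext1 i j
  simp [he]

/-- A univariate polynomial, viewed as a polynomial in the first variable. -/
noncomputable def inFirst (K : Type*) [Field K] (n : ℕ) :
    Polynomial K →ₐ[K] MvPolynomial (Fin (n + 1)) K :=
  Polynomial.aeval (X 0)

/-- A polynomial in `n` variables, viewed as a polynomial in the last `n` of `n + 1` variables. -/
noncomputable def inRest (K : Type*) [Field K] (n : ℕ) :
    MvPolynomial (Fin n) K →ₐ[K] MvPolynomial (Fin (n + 1)) K :=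
  rename Fin.succ

lemma inFirst_mul_inRest_monomial (b : ℕ) (ν : Fin n →₀ ℕ) (c e : K) :
    inFirst K n (Polynomial.monomial b c) * inRest K n (monomial ν e) =
      monomial (Finsupp.cons b ν) (c * e) := by
  have h : (Finsupp.cons b ν : Fin (n + 1) →₀ ℕ) =
      Finsupp.single 0 b + Finsupp.mapDomain Fin.succ ν := by
    ext i
    refine Fin.cases ?_ (fun j => ?_) i
    · rw [Finsupp.add_apply, Finsupp.mapDomain_of_notMem_range]
      · simp
      · rintro ⟨j, hj⟩
        exact Fin.succ_ne_zero j hj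
    · rw [Finsupp.add_apply, Finsupp.mapDomain_apply (Fin.succ_injective n)]
      simp
  rw [inFirst, inRest, rename_monomial, Polynomial.aeval_monomial, h, algebraMap_eq,
    C_mul_X_pow_eq_monomial, monomial_mul]

lemma hasse_inFirst_mul_inRest (b : ℕ) (a : Fin n →₀ ℕ) (ψ : Polynomial K)
    (φ : MvPolynomial (Fin n) K) :
    hasse (Finsupp.cons b a) (inFirst K n ψ * inRest K n φ) =
      inFirst K n (Polynomial.hasseDeriv b ψ) * inRest K n (hasse a φ) := by
  induction ψ using Polynomial.induction_on' with
  | monomial m c =>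
    induction φ using MvPolynomial.induction_on' with
    | monomial ν e =>
      rw [inFirst_mul_inRest_monomial, hasse_monomial, hasse_monomial,
        Polynomial.hasseDeriv_monomial, inFirst_mul_inRest_monomial]
      have h1 : (Finsupp.cons m ν - Finsupp.cons b a : Fin (n + 1) →₀ ℕ) =
          Finsupp.cons (m - b) (ν - a) := by
        ext i
        refine Fin.cases ?_ (fun j => ?_) i <;> simp
      have h2 : multichoose (Finsupp.cons m ν : Fin (n + 1) →₀ ℕ) (Finsupp.cons b a) =
          m.choose b * multichoose ν a := by
        simp [multichoose, Fin.prod_univ_succ]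
      rw [h1, h2]
      congr 1
      push_cast
      ring
    | add p q hp hq => simp only [map_add, mul_add, hp, hq]
  | add p q hp hq => simp only [map_add, add_mul, hp, hq]

lemma coeff_inFirst_mul_inRest (b : ℕ) (a : Fin n →₀ ℕ) (ψ : Polynomial K)
    (φ : MvPolynomial (Fin n) K) :
    coeff (Finsupp.cons b a) (inFirst K n ψ * inRest K n φ) = ψ.coeff b * coeff a φ := by
  classical
  induction ψ using Polynomial.induction_on' with
  | monomial m c =>
    induction φ using MvPolynomial.induction_on' with
    | monomial ν e =>
      rw [inFirst_mul_inRest_monomial, coeff_monomial, coeff_monomial, Polynomial.coeff_monomial]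
      by_cases h : m = b <;> by_cases h' : ν = a <;> simp [h, h', Finsupp.cons_injective2.eq_iff]
    | add p q hp hq => simp only [map_add, mul_add, coeff_add, hp, hq]
  | add p q hp hq => simp only [map_add, add_mul, coeff_add, Polynomial.coeff_add, hp, hq]

lemma eval_inFirst (x : Fin (n + 1) → K) (ψ : Polynomial K) :
    eval x (inFirst K n ψ) = ψ.eval (x 0) := by
  induction ψ using Polynomial.induction_on' with
  | monomial m c => simp [inFirst, Polynomial.aeval_monomial]
  | add p q hp hq => simp [hp, hq]

lemma eval_inRest (x : Fin (n + 1) → K) (φ : MvPolynomial (Fin n) K) :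
    eval x (inRest K n φ) = eval (fun i => x i.succ) φ := by
  rw [inRest, eval_rename]
  rfl

/-- Decomposition of a polynomial as a sum of products, with a minimal number of terms. -/
lemma exists_sum_inFirst_mul_inRest {P : MvPolynomial (Fin (n + 1)) K} (hP : P ≠ 0) {d : ℕ}
    (hd : degreeOf 0 P ≤ d) :
    ∃ (k : ℕ) (ψ : Fin k → Polynomial K) (φ : Fin k → MvPolynomial (Fin n) K),
      0 < k ∧ k ≤ d + 1 ∧ LinearIndependent K ψ ∧ LinearIndependent K φ ∧
        P = ∑ l, inFirst K n (ψ l) * inRest K n (φ l) := by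
  let c : Fin (d + 1) → MvPolynomial (Fin n) K := fun b => (finSuccEquiv K n P).coeff b
  let V := Submodule.span K (Set.range c)
  have hc : ∀ b, c b ∈ V := fun b => Submodule.subset_span ⟨b, rfl⟩
  have : Module.Finite K V := Module.Finite.span_of_finite K (Set.finite_range c)
  let B := Module.finBasis K V
  let ψ : Fin (Module.finrank K V) → Polynomial K := fun l =>
    ∑ b : Fin (d + 1), Polynomial.monomial b (B.repr ⟨c b, hc b⟩ l)
  have hψc : ∀ l (b : Fin (d + 1)), (ψ l).coeff b = B.repr ⟨c b, hc b⟩ l := by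
    intro l b
    simp [ψ, Polynomial.finsetSum_coeff, Polynomial.coeff_monomial, Fin.val_inj]
  have hψ0 : ∀ l (b : ℕ), d < b → (ψ l).coeff b = 0 := by
    intro l b hb
    simp only [ψ, Polynomial.finsetSum_coeff, Polynomial.coeff_monomial]
    refine Finset.sum_eq_zero fun i _ => if_neg ?_
    have := i.2
    omega
  have hsum : P = ∑ l, inFirst K n (ψ l) * inRest K n ((B l : V) : MvPolynomial (Fin n) K) := by
    ext κ
    obtain ⟨b, a, rfl⟩ : ∃ b a, κ = Finsupp.cons b a := ⟨κ 0, κ.tail, (Finsupp.cons_tail κ).symm⟩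
    rw [coeff_sum]
    simp only [coeff_inFirst_mul_inRest]
    rcases lt_or_ge d b with hb | hb
    · simp only [hψ0 _ b hb, zero_mul, Finset.sum_const_zero]
      rw [← finSuccEquiv_coeff_coeff, Polynomial.coeff_eq_zero_of_natDegree_lt, coeff_zero]
      rw [natDegree_finSuccEquiv]
      exact hd.trans_lt hb
    · have h1 := congrArg (fun v : V => coeff a (v : MvPolynomial (Fin n) K))
        (B.sum_repr ⟨c ⟨b, Nat.lt_succ_of_le hb⟩, hc _⟩)
      simp only [Submodule.coe_sum, Submodule.coe_smul, coeff_sum, coeff_smul, smul_eq_mul,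
        ← hψc] at h1
      rw [h1, ← finSuccEquiv_coeff_coeff]
  refine ⟨_, ψ, fun l => B l, ?_, ?_, ?_, ?_, hsum⟩
  · refine Nat.pos_of_ne_zero fun h0 => hP ?_
    rw [hsum]
    have : IsEmpty (Fin (Module.finrank K V)) := by rw [h0]; infer_instance
    simp
  · exact (finrank_range_le_card (R := K) c).trans (by simp)
  · rw [Fintype.linearIndependent_iff]
    intro g hg l
    let F : V →ₗ[K] K := ∑ l, g l • B.coord l
    have hF : ∀ b, F ⟨c b, hc b⟩ = 0 := by
      intro b
      have := congrArg (Polynomial.coeff · (b : ℕ)) hg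
      simpa [F, Polynomial.finsetSum_coeff, hψc] using this
    have hle : V ≤ (LinearMap.ker F).map V.subtype := by
      refine Submodule.span_le.mpr ?_
      rintro _ ⟨b, rfl⟩
      exact ⟨⟨c b, hc b⟩, hF b, rfl⟩
    obtain ⟨w, hw, hwl⟩ := hle (B l).2
    have hwB : w = B l := Subtype.ext hwl
    have h2 : F (B l) = 0 := hwB ▸ hw
    simpa [F, Finsupp.single_apply] using h2
  · exact B.linearIndependent.map' V.subtype (Submodule.ker_subtype V)

end Tensor

end RothTheorem

namespace RothTheorem

section OneVariable

open Polynomial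

lemma isPrimitive_C_mul_X_sub_C {p q : ℤ} (h : IsCoprime p q) :
    (C q * X - C p : ℤ[X]).IsPrimitive := by
  intro r hr
  rw [C_dvd_iff_dvd_coeff] at hr
  have h0 := hr 0
  have h1 := hr 1
  simp only [coeff_sub, coeff_C_mul, coeff_X_zero, mul_zero, coeff_C_zero, zero_sub,
    dvd_neg, coeff_X_one, mul_one, coeff_C_succ, sub_zero] at h0 h1
  exact h.isUnit_of_dvd' h0 h1

lemma isPrimitive_pow {f : ℤ[X]} (hf : f.IsPrimitive) (e : ℕ) : (f ^ e).IsPrimitive := by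
  induction e with
  | zero => simp
  | succ e ih => exact pow_succ f e ▸ ih.mul hf

/-- The order of vanishing of an integer polynomial at a rational point is bounded in terms of its
leading coefficient. -/
lemma exists_hasseDeriv_eval_ne_zero {V : ℤ[X]} (hV : V ≠ 0) {p q : ℤ} (hq : 0 < q)
    (h : IsCoprime p q) :
    ∃ e : ℕ, (hasseDeriv e (V.map (Int.castRingHom ℚ))).eval ((p : ℚ) / q) ≠ 0 ∧
      q ^ e ≤ |V.leadingCoeff| := by
  have hV' : V.map (Int.castRingHom ℚ) ≠ 0 :=
    (Polynomial.map_ne_zero_iff Int.cast_injective).mpr hV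
  set β : ℚ := (p : ℚ) / q with hβ
  obtain ⟨g, hg, hgβ⟩ := exists_eq_pow_rootMultiplicity_mul_and_not_dvd _ hV' β
  set e := rootMultiplicity β (V.map (Int.castRingHom ℚ))
  refine ⟨e, ?_, ?_⟩
  · rw [← taylor_coeff, hg, taylor_mul, taylor_pow, map_sub, taylor_X, taylor_C,
      add_sub_cancel_right,
      coeff_X_pow_mul', if_pos le_rfl, Nat.sub_self, taylor_coeff_zero]
    rwa [dvd_iff_isRoot] at hgβ
  · have hqQ : (q : ℚ) ≠ 0 := by exact_mod_cast hq.ne'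
    have hdvd : (C q * X - C p : ℤ[X]) ^ e ∣ V := by
      rw [IsPrimitive.Int.dvd_iff_map_cast_dvd_map_cast _ _
        (isPrimitive_pow (isPrimitive_C_mul_X_sub_C h) e)]
      have : ((C q * X - C p : ℤ[X]) ^ e).map (Int.castRingHom ℚ) =
          C ((q : ℚ) ^ e) * (X - C β) ^ e := by
        rw [C_pow, ← mul_pow, mul_sub, ← C_mul, hβ, mul_div_cancel₀ _ hqQ]
        simp
      rw [this, hg]
      exact (IsUnit.mul_left_dvd (isUnit_C.mpr (IsUnit.mk0 _ (pow_ne_zero e hqQ)))).mpr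
        (dvd_mul_right _ _)
    obtain ⟨G, hG⟩ := hdvd
    have hlc : (C q * X - C p : ℤ[X]).leadingCoeff = q := by
      have := leadingCoeff_linear (b := -p) hq.ne'
      simpa [sub_eq_add_neg] using this
    have h2 : q ^ e ∣ V.leadingCoeff := by
      rw [hG, leadingCoeff_mul, leadingCoeff_pow, hlc]
      exact dvd_mul_right _ _
    exact Int.le_of_dvd (abs_pos.mpr (leadingCoeff_ne_zero.mpr hV)) ((dvd_abs _ _).mpr h2)

end OneVariable

open MvPolynomial

section Index

variable {σ R : Type*} [Fintype σ] [CommRing R]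

/-- The weighted degree of a multi-index relative to the degrees `d`. -/
noncomputable def weight (d : σ → ℕ) (ν : σ →₀ ℕ) : ℝ := ∑ i, (ν i : ℝ) / d i

lemma weight_nonneg (d : σ → ℕ) (ν : σ →₀ ℕ) : 0 ≤ weight d ν :=
  Finset.sum_nonneg fun _ _ => by positivity

lemma weight_add (d : σ → ℕ) (ν κ : σ →₀ ℕ) : weight d (ν + κ) = weight d ν + weight d κ := by
  simp [weight, add_div, Finset.sum_add_distrib]

/-- The polynomial `P` has index at least `s` at the point `b`, relative to the degrees `d`. -/
def IndexGE (d : σ → ℕ) (b : σ → R) (s : ℝ) (P : MvPolynomial σ R) : Prop :=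
  ∀ ν, weight d ν < s → eval b (hasse ν P) = 0

variable {d : σ → ℕ} {b : σ → R}

lemma indexGE_zero_left (P : MvPolynomial σ R) : IndexGE d b 0 P :=
  fun ν hν => absurd hν (weight_nonneg d ν).not_gt

lemma IndexGE.max_zero {s : ℝ} {P : MvPolynomial σ R} (h : IndexGE d b s P) :
    IndexGE d b (max 0 s) P :=
  fun ν hν => h ν ((lt_max_iff.mp hν).resolve_left (weight_nonneg d ν).not_gt)

lemma IndexGE.mul {s t : ℝ} {P Q : MvPolynomial σ R} (hP : IndexGE d b s P)
    (hQ : IndexGE d b t Q) : IndexGE d b (s + t) (P * Q) := by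
  classical
  intro ν hν
  rw [← coeff_translate, map_mul, coeff_mul]
  refine Finset.sum_eq_zero fun x hx => ?_
  rw [Finset.HasAntidiagonal.mem_antidiagonal] at hx
  rw [← hx, weight_add] at hν
  rcases lt_or_ge (weight d x.1) s with h | h
  · rw [coeff_translate, hP _ h, zero_mul]
  · rw [coeff_translate _ Q, hQ _ (by linarith), mul_zero]

lemma IndexGE.sum {ι : Type*} {s : ℝ} {u : Finset ι} {f : ι → MvPolynomial σ R}
    (h : ∀ i ∈ u, IndexGE d b s (f i)) : IndexGE d b s (∑ i ∈ u, f i) := by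
  intro ν hν
  rw [map_sum, map_sum]
  exact Finset.sum_eq_zero fun i hi => h i hi ν hν

lemma IndexGE.prod {ι : Type*} {u : Finset ι} {s : ι → ℝ} {f : ι → MvPolynomial σ R}
    (h : ∀ i ∈ u, IndexGE d b (s i) (f i)) : IndexGE d b (∑ i ∈ u, s i) (∏ i ∈ u, f i) := by
  classical
  induction u using Finset.induction_on with
  | empty => simpa using indexGE_zero_left _
  | insert a u ha ih =>
    rw [Finset.sum_insert ha, Finset.prod_insert ha]
    exact (h a (Finset.mem_insert_self _ _)).mul
      (ih fun i hi => h i (Finset.mem_insert_of_mem hi))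

lemma IndexGE.det {k : ℕ} {M : Matrix (Fin k) (Fin k) (MvPolynomial σ R)} {s : Fin k → ℝ}
    (h : ∀ i j, IndexGE d b (s j) (M i j)) : IndexGE d b (∑ j, s j) M.det := by
  rw [Matrix.det_apply]
  refine IndexGE.sum fun τ _ => ?_
  have h1 : IndexGE d b (∑ j, s j) (∏ i, M (τ i) i) := IndexGE.prod fun i _ => h _ _
  intro ν hν
  rcases Int.units_eq_one_or (Equiv.Perm.sign τ) with h2 | h2 <;> rw [h2] <;> simp [h1 ν hν]

lemma IndexGE.hasse {s : ℝ} {P : MvPolynomial σ R} (h : IndexGE d b s P) (μ : σ →₀ ℕ) :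
    IndexGE d b (s - weight d μ) (hasse μ P) := by
  intro ν hν
  rw [hasse_hasse, smul_eval, h _ (by rw [weight_add]; linarith), mul_zero]

end Index

lemma le_sum_max {k d : ℕ} (hd : 0 < d) (hk : k ≤ d + 1) {η : ℝ} (hη : 0 < η) (hη1 : η ≤ 1) :
    k * (η ^ 2 / 8) ≤ ∑ j : Fin k, max 0 (η - (j : ℕ) / (d : ℝ)) := by
  rw [Fin.sum_univ_eq_sum_range fun j => max 0 (η - (j : ℕ) / (d : ℝ))]
  have hd' : (0 : ℝ) < d := by exact_mod_cast hd
  set t := ⌊η * d / 2⌋₊ + 1 with ht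
  set m := min k t
  have h1 : ∑ j ∈ Finset.range m, (η / 2) ≤
      ∑ j ∈ Finset.range k, max 0 (η - (j : ℕ) / (d : ℝ)) := by
    refine (Finset.sum_le_sum fun j hj => ?_).trans (Finset.sum_le_sum_of_subset_of_nonneg
      (Finset.range_subset_range.mpr (min_le_left k t)) fun _ _ _ => le_max_left _ _)
    have hj' : j ≤ ⌊η * d / 2⌋₊ := by
      have := (Finset.mem_range.mp hj).trans_le (min_le_right k t)
      omega
    have hj2 : (j : ℝ) ≤ η * d / 2 := (Nat.le_floor_iff (by positivity)).mp hj'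
    refine le_max_of_le_right ?_
    have : (j : ℝ) / d ≤ η / 2 := by
      rw [div_le_iff₀ hd']
      linarith
    linarith
  refine le_trans ?_ h1
  rw [Finset.sum_const, Finset.card_range, nsmul_eq_mul]
  have hm : (k : ℝ) * (η / 4) ≤ m := by
    have hk' : (k : ℝ) ≤ d + 1 := by exact_mod_cast hk
    have hd1 : (1 : ℝ) ≤ d := by exact_mod_cast hd
    have hk0 : (0 : ℝ) ≤ k := Nat.cast_nonneg k
    rcases min_choice k t with h | h
    · rw [show m = k from h]
      nlinarith
    · rw [show m = t from h, ht]
      have := (Nat.lt_floor_add_one (η * d / 2)).le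
      push_cast
      nlinarith
  nlinarith

lemma degreeOf_det_le {σ : Type*} {k : ℕ} (M : Matrix (Fin k) (Fin k) (MvPolynomial σ ℤ)) (x : σ)
    {D : ℕ} (h : ∀ i j, degreeOf x (M i j) ≤ D) : degreeOf x M.det ≤ k * D := by
  rw [Matrix.det_apply]
  refine (degreeOf_sum_le _ _ _).trans (Finset.sup_le fun τ _ => ?_)
  have h1 : degreeOf x (∏ i, M (τ i) i) ≤ k * D :=
    (degreeOf_prod_le _ _ _).trans ((Finset.sum_le_sum fun i _ => h (τ i) i).trans (by simp))
  rcases Int.units_eq_one_or (Equiv.Perm.sign τ) with h2 | h2 <;> rw [h2]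
  · simpa using h1
  · rw [degreeOf_le_iff] at h1 ⊢
    simpa using h1

lemma log_length_det_hasse_le {σ : Type*} [Fintype σ] {k D : ℕ} (hk0 : 0 < k) (hk : k ≤ D + 1)
    {d : σ → ℕ} {P : MvPolynomial σ ℤ} (hP : P ≠ 0) (hd : ∀ i, degreeOf i P ≤ d i)
    (μ : Fin k → Fin k → σ →₀ ℕ)
    (h0 : (Matrix.of fun i j => hasse (μ i j) P).det ≠ 0) :
    Real.log (length (Matrix.of fun i j => hasse (μ i j) P).det) ≤
      k * (D + ∑ i, (d i : ℝ) + Real.log (length P)) := by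
  have hlen : (1 : ℝ) ≤ length P := by exact_mod_cast one_le_length hP
  have h1 : (length (Matrix.of fun i j => hasse (μ i j) P).det : ℝ) ≤
      k.factorial * (2 ^ (∑ i, d i) * length P) ^ k := by
    exact_mod_cast length_det_le _ fun i j => length_hasse_le (μ i j) P hd
  have hpos : (0 : ℝ) < length (Matrix.of fun i j => hasse (μ i j) P).det := by
    exact_mod_cast one_le_length h0
  have hkR : (0 : ℝ) < k := by exact_mod_cast hk0
  refine (Real.log_le_log hpos h1).trans ?_
  rw [Real.log_mul (by positivity) (by positivity), Real.log_pow,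
    Real.log_mul (by positivity) (by positivity), Real.log_pow]
  have h2 : Real.log k.factorial ≤ k * D := by
    have h3 : (k.factorial : ℝ) ≤ (k : ℝ) ^ k := by exact_mod_cast Nat.factorial_le_pow k
    refine (Real.log_le_log (by positivity) h3).trans ?_
    rw [Real.log_pow]
    have h4 := Real.log_le_sub_one_of_pos hkR
    have h5 : (k : ℝ) ≤ D + 1 := by exact_mod_cast hk
    exact mul_le_mul_of_nonneg_left (by linarith) hkR.le
  have h6 : Real.log 2 ≤ 1 := by
    have := Real.log_le_sub_one_of_pos (show (0 : ℝ) < 2 by norm_num)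
    linarith
  have h7 : ((∑ i, d i : ℕ) : ℝ) * Real.log 2 ≤ ∑ i, (d i : ℝ) := by
    rw [← Nat.cast_sum]
    exact mul_le_of_le_one_right (Nat.cast_nonneg _) h6
  nlinarith

end RothTheorem

namespace RothTheorem

open MvPolynomial

section Factor

variable {n : ℕ}

/-- A generalized Wronskian of an integer polynomial which is nonzero and splits off the first
variable. -/
lemma exists_map_det_hasse_eq_mul {P : MvPolynomial (Fin (n + 1)) ℤ} (hP : P ≠ 0) {D : ℕ}
    (hD : degreeOf 0 P ≤ D) :
    ∃ (k : ℕ) (b : Fin k → ℕ) (μ : Fin k → Fin n →₀ ℕ) (V : Polynomial ℚ)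
      (U : MvPolynomial (Fin n) ℚ), 0 < k ∧ k ≤ D + 1 ∧ (∀ i, b i ≤ i) ∧
      (∀ i, ∑ h, μ i h ≤ i) ∧ V ≠ 0 ∧ U ≠ 0 ∧
      map (Int.castRingHom ℚ) (Matrix.of fun i j => hasse (Finsupp.cons (b j) (μ i)) P).det =
        inFirst ℚ n V * inRest ℚ n U := by
  have hinj : Function.Injective (Int.castRingHom ℚ) := Int.cast_injective
  have hP' : map (Int.castRingHom ℚ) P ≠ 0 := fun h =>
    hP (map_injective _ hinj (by rw [h, map_zero]))
  obtain ⟨k, ψ, φ, hk0, hk, hψ, hφ, hsum⟩ := exists_sum_inFirst_mul_inRest hP'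
    (d := D) (degreeOf_le_iff.mpr fun m hm =>
      degreeOf_le_iff.mp hD m (support_map_subset _ _ hm))
  obtain ⟨b, hb, hV⟩ := exists_det_hasseDeriv_ne_zero ψ hψ
  obtain ⟨μ, hμ, hU⟩ := exists_det_hasse_ne_zero φ hφ
  refine ⟨k, b, μ, _, _, hk0, hk, hb, hμ, hV, hU, ?_⟩
  rw [RingHom.map_det, AlgHom.map_det, AlgHom.map_det,
    ← Matrix.det_transpose (AlgHom.mapMatrix _ _),
    mul_comm, ← Matrix.det_mul]
  congr 1
  ext1 i j
  simp only [RingHom.mapMatrix_apply, Matrix.map_apply, Matrix.of_apply, map_hasse, hsum, map_sum,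
    hasse_inFirst_mul_inRest, Matrix.mul_apply, Matrix.transpose_apply, AlgHom.mapMatrix_apply]
  exact Finset.sum_congr rfl fun l _ => mul_comm _ _

variable {W : MvPolynomial (Fin (n + 1)) ℤ} {V : Polynomial ℚ} {U : MvPolynomial (Fin n) ℚ}

lemma cast_coeff_cons (h : map (Int.castRingHom ℚ) W = inFirst ℚ n V * inRest ℚ n U) (b : ℕ)
    (a : Fin n →₀ ℕ) : ((coeff (Finsupp.cons b a) W : ℤ) : ℚ) = V.coeff b * coeff a U := by
  rw [← coeff_inFirst_mul_inRest, ← h, coeff_map]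
  rfl

lemma exists_map_eq_C_mul_rest (h : map (Int.castRingHom ℚ) W = inFirst ℚ n V * inRest ℚ n U)
    (hV : V ≠ 0) (hU : U ≠ 0) :
    ∃ (U' : MvPolynomial (Fin n) ℤ) (c : ℚ), map (Int.castRingHom ℚ) U' = C c * U ∧ U' ≠ 0 ∧
      (∀ i, degreeOf i U' ≤ degreeOf i.succ W) ∧ length U' ≤ length W := by
  have hmap : map (Int.castRingHom ℚ) ((finSuccEquiv ℤ n W).coeff V.natDegree) =
      C V.leadingCoeff * U := by
    ext a
    rw [coeff_map, finSuccEquiv_coeff_coeff, coeff_C_mul]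
    exact cast_coeff_cons h _ _
  refine ⟨(finSuccEquiv ℤ n W).coeff V.natDegree, V.leadingCoeff, hmap, ?_,
    fun i => degreeOf_coeff_finSuccEquiv W i _, ?_⟩
  · intro h0
    rw [h0, map_zero] at hmap
    exact mul_ne_zero (C_ne_zero.mpr (Polynomial.leadingCoeff_ne_zero.mpr hV)) hU hmap.symm
  · rw [length_eq_of_subset subset_rfl]
    simp_rw [finSuccEquiv_coeff_coeff]
    rw [← Finset.sum_image (f := fun ν => |coeff ν W|)
      (g := fun a => Finsupp.cons V.natDegree a) (Finsupp.cons_right_injective _).injOn]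
    exact sum_abs_coeff_le_length _ _

lemma exists_map_eq_C_mul_first (h : map (Int.castRingHom ℚ) W = inFirst ℚ n V * inRest ℚ n U)
    (hV : V ≠ 0) (hU : U ≠ 0) :
    ∃ (V' : Polynomial ℤ) (c : ℚ), V'.map (Int.castRingHom ℚ) = Polynomial.C c * V ∧ V' ≠ 0 ∧
      |V'.leadingCoeff| ≤ length W := by
  obtain ⟨a, ha⟩ := ne_zero_iff.mp hU
  have hcoeff : ∀ m, (∑ b ∈ Finset.range (V.natDegree + 1),
      Polynomial.monomial b (coeff (Finsupp.cons b a) W)).coeff m =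
      coeff (Finsupp.cons m a) W := by
    intro m
    simp only [Polynomial.finsetSum_coeff, Polynomial.coeff_monomial, Finset.sum_ite_eq',
      Finset.mem_range]
    split_ifs with hm
    · rfl
    · have := cast_coeff_cons h m a
      rw [Polynomial.coeff_eq_zero_of_natDegree_lt (by omega), zero_mul] at this
      exact_mod_cast this.symm
  have hmap : (∑ b ∈ Finset.range (V.natDegree + 1),
      Polynomial.monomial b (coeff (Finsupp.cons b a) W)).map (Int.castRingHom ℚ) =
      Polynomial.C (coeff a U) * V := by
    ext m
    rw [Polynomial.coeff_map, hcoeff, Polynomial.coeff_C_mul, mul_comm]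
    exact cast_coeff_cons h _ _
  refine ⟨_, _, hmap, ?_, ?_⟩
  · intro h0
    rw [h0, Polynomial.map_zero] at hmap
    exact mul_ne_zero (Polynomial.C_ne_zero.mpr ha) hV hmap.symm
  · rw [Polynomial.leadingCoeff, hcoeff]
    exact abs_coeff_le_length _ _

end Factor

end RothTheorem

namespace RothTheorem

open MvPolynomial

/-- The hypotheses of Roth's lemma: the degrees `d` increase rapidly, the heights `q i ^ d i` are
all at least `exp L`, and the coefficients of `P` are small compared with `exp L`. -/
structure RothData {n : ℕ} (δ L : ℝ) (d : Fin n → ℕ) (p : Fin n → ℤ) (q : Fin n → ℕ)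
    (P : MvPolynomial (Fin n) ℤ) : Prop where
  ne_zero : P ≠ 0
  degree_pos : ∀ i, 0 < d i
  degree_le_mul : ∀ i j, i < j → (d i : ℝ) ≤ δ * d j
  denom_pos : ∀ i, 0 < q i
  coprime : ∀ i, IsCoprime (p i) (q i : ℤ)
  pos : 0 < L
  degree_le : ∀ i, (d i : ℝ) ≤ δ * L
  le_log : ∀ i, L ≤ d i * Real.log (q i)
  degreeOf_le : ∀ i, degreeOf i P ≤ d i
  log_length_le : Real.log (length P) ≤ δ * L

lemma IndexGE.mono {σ R : Type*} [Fintype σ] [CommRing R] {d : σ → ℕ} {b : σ → R} {s t : ℝ}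
    {P : MvPolynomial σ R} (h : IndexGE d b s P) (hts : t ≤ s) : IndexGE d b t P :=
  fun ν hν => h ν (hν.trans_le hts)

lemma weight_cons {n : ℕ} (d : Fin (n + 1) → ℕ) (e : ℕ) (a : Fin n →₀ ℕ) :
    weight d (Finsupp.cons e a) = (e : ℝ) / d 0 + weight (fun i => d i.succ) a := by
  simp [weight, Fin.sum_univ_succ]

lemma weight_mul {n : ℕ} (d : Fin n → ℕ) {k : ℕ} (hk : 0 < k) (a : Fin n →₀ ℕ) :
    weight d a = k * weight (fun i => k * d i) a := by
  have : (k : ℝ) ≠ 0 := by positivity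
  simp only [weight, Finset.mul_sum]
  refine Finset.sum_congr rfl fun i _ => ?_
  rw [Nat.cast_mul, ← mul_div_assoc, mul_div_mul_left _ _ this]

lemma eval_hasse_of_map_eq_C_mul {n : ℕ} {U : MvPolynomial (Fin n) ℚ}
    {U' : MvPolynomial (Fin n) ℤ} {c : ℚ} (h : map (Int.castRingHom ℚ) U' = C c * U)
    (x : Fin n → ℚ) (a : Fin n →₀ ℕ) :
    eval x (hasse a (map (Int.castRingHom ℚ) U')) = c * eval x (hasse a U) := by
  rw [h, ← smul_eq_C_mul, map_smul, smul_eval]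

lemma eval_hasseDeriv_of_map_eq_C_mul {V : Polynomial ℚ} {V' : Polynomial ℤ} {c : ℚ}
    (h : V'.map (Int.castRingHom ℚ) = Polynomial.C c * V) (x : ℚ) (e : ℕ) :
    (Polynomial.hasseDeriv e (V'.map (Int.castRingHom ℚ))).eval x =
      c * (Polynomial.hasseDeriv e V).eval x := by
  rw [h, ← Polynomial.smul_eq_C_mul, map_smul, Polynomial.eval_smul, smul_eq_mul]

section Step

variable {n : ℕ} {δ δ' ε L : ℝ} {d : Fin (n + 1) → ℕ} {p : Fin (n + 1) → ℤ} {q : Fin (n + 1) → ℕ}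
  {P W : MvPolynomial (Fin (n + 1)) ℤ} {V : Polynomial ℚ} {U : MvPolynomial (Fin n) ℚ} {k : ℕ}

lemma exists_eval_hasse_wronskian_ne_zero (hδ : 0 < δ) (hδδ' : (n + 4) * δ ≤ δ')
    (hδε : (n + 4) * δ ≤ ε) (hP : RothData δ L d p q P)
    (ih : ∀ (d : Fin n → ℕ) (p : Fin n → ℤ) (q : Fin n → ℕ) (L : ℝ) (P : MvPolynomial (Fin n) ℤ),
      RothData δ' L d p q P → ∃ μ, weight d μ ≤ ε ∧
        eval (fun i => (p i : ℚ) / q i) (hasse μ (map (Int.castRingHom ℚ) P)) ≠ 0)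
    (hk : 0 < k) (h : map (Int.castRingHom ℚ) W = inFirst ℚ n V * inRest ℚ n U)
    (hV : V ≠ 0) (hU : U ≠ 0) (hdeg : ∀ i, degreeOf i W ≤ k * d i)
    (hlen : Real.log (length W) ≤ k * ((n + 3) * δ * L)) :
    ∃ μ, weight d μ ≤ 2 * k * ε ∧
      eval (fun i => (p i : ℚ) / q i) (hasse μ (map (Int.castRingHom ℚ) W)) ≠ 0 := by
  have hL := hP.pos
  have hkR : (0 : ℝ) < k := by exact_mod_cast hk
  have hn : (0 : ℝ) ≤ n := n.cast_nonneg
  have hδ'1 : δ ≤ δ' := by nlinarith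
  have hlen' : ∀ {x : ℝ}, (n + 4) * δ ≤ x → Real.log (length W) ≤ x * (k * L) := by
    intro x hx
    refine hlen.trans ?_
    have : (n + 3) * δ ≤ x := by linarith
    calc k * ((n + 3) * δ * L) = ((n + 3) * δ) * (k * L) := by ring
      _ ≤ x * (k * L) := by gcongr
  obtain ⟨U', c, hU', hU'0, hU'd, hU'l⟩ := exists_map_eq_C_mul_rest h hV hU
  obtain ⟨V', c', hV', hV'0, hV'l⟩ := exists_map_eq_C_mul_first h hV hU
  have hU'pos : (1 : ℝ) ≤ length U' := by exact_mod_cast one_le_length hU'0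
  have hWpos : (1 : ℝ) ≤ length W := hU'pos.trans (by exact_mod_cast hU'l)
  obtain ⟨a, ha, haU⟩ := ih (fun i => k * d i.succ) (fun i => p i.succ) (fun i => q i.succ)
    (k * L) U'
    { ne_zero := hU'0
      degree_pos := fun i => mul_pos hk (hP.degree_pos _)
      degree_le_mul := fun i j hij => by
        have h1 := hP.degree_le_mul i.succ j.succ (Fin.succ_lt_succ_iff.mpr hij)
        push_cast
        calc (k : ℝ) * d i.succ ≤ k * (δ * d j.succ) := by gcongr
          _ ≤ k * (δ' * d j.succ) := by gcongr
          _ = _ := by ring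
      denom_pos := fun i => hP.denom_pos _
      coprime := fun i => hP.coprime _
      pos := by positivity
      degree_le := fun i => by
        have h1 := hP.degree_le i.succ
        push_cast
        calc (k : ℝ) * d i.succ ≤ k * (δ * L) := by gcongr
          _ ≤ k * (δ' * L) := by gcongr
          _ = _ := by ring
      le_log := fun i => by
        have h1 := hP.le_log i.succ
        push_cast
        rw [mul_assoc]
        gcongr
      degreeOf_le := fun i => (hU'd i).trans (hdeg _)
      log_length_le := (Real.log_le_log (by linarith) (by exact_mod_cast hU'l)).trans
        (hlen' hδδ') }
  obtain ⟨e, he, hqe⟩ := exists_hasseDeriv_eval_ne_zero hV'0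
    (by exact_mod_cast hP.denom_pos 0) (hP.coprime 0)
  have hd0 : (0 : ℝ) < d 0 := by exact_mod_cast hP.degree_pos 0
  have hlog0 : 0 < Real.log (q 0) := pos_of_mul_pos_right (hL.trans_le (hP.le_log 0)) hd0.le
  have hq0 : (0 : ℝ) < q 0 := by exact_mod_cast hP.denom_pos 0
  have hed : (e : ℝ) / d 0 ≤ k * ε := by
    have h1 : (q 0 : ℝ) ^ e ≤ length W := by exact_mod_cast hqe.trans hV'l
    have h2 := Real.log_le_log (by positivity) h1
    rw [Real.log_pow] at h2
    have hε : 0 ≤ ε := le_trans (by positivity) hδε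
    have h3 : (e : ℝ) * Real.log (q 0) ≤ (k * ε * d 0) * Real.log (q 0) := by
      calc (e : ℝ) * Real.log (q 0) ≤ ε * (k * L) := h2.trans (hlen' hδε)
        _ ≤ ε * (k * (d 0 * Real.log (q 0))) := by
          have := hP.le_log 0
          gcongr
        _ = _ := by ring
    rw [div_le_iff₀ hd0]
    exact le_of_mul_le_mul_right h3 hlog0
  refine ⟨Finsupp.cons e a, ?_, ?_⟩
  · rw [weight_cons, weight_mul _ hk]
    have := mul_le_mul_of_nonneg_left ha hkR.le
    linarith
  · rw [h, hasse_inFirst_mul_inRest, map_mul, eval_inFirst, eval_inRest]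
    rw [eval_hasse_of_map_eq_C_mul hU'] at haU
    rw [eval_hasseDeriv_of_map_eq_C_mul hV'] at he
    exact mul_ne_zero (right_ne_zero_of_mul (by simpa using he)) (right_ne_zero_of_mul haU)

lemma indexGE_wronskian {x : Fin (n + 1) → ℚ}
    (hδ0 : 0 < δ) (hδ : δ ≤ ε / 2) (hε : 0 < ε) (hε1 : ε ≤ 1)
    (hd : ∀ i, 0 < d i) (hdd : ∀ i j, i < j → (d i : ℝ) ≤ δ * d j) (hk : k ≤ d 0 + 1)
    {b : Fin k → ℕ} {μ : Fin k → Fin n →₀ ℕ} (hb : ∀ i, b i ≤ i) (hμ : ∀ i, ∑ h, μ i h ≤ i)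
    (hP : IndexGE d x ε (map (Int.castRingHom ℚ) P)) :
    IndexGE d x (k * (ε ^ 2 / 32)) (map (Int.castRingHom ℚ)
      (Matrix.of fun i j => hasse (Finsupp.cons (b j) (μ i)) P).det) := by
  have hd0 : (0 : ℝ) < d 0 := by exact_mod_cast hd 0
  have h1 := le_sum_max (hd 0) hk (half_pos hε) (by linarith)
  refine IndexGE.mono ?_ (le_trans (le_of_eq (by ring)) h1)
  rw [RingHom.map_det]
  refine IndexGE.det fun i j => IndexGE.max_zero ?_
  simp only [RingHom.mapMatrix_apply, Matrix.map_apply, Matrix.of_apply, map_hasse]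
  refine (hP.hasse _).mono ?_
  rw [weight_cons]
  have h2 : (b j : ℝ) / d 0 ≤ (j : ℕ) / (d 0 : ℝ) := by
    have : (b j : ℝ) ≤ (j : ℕ) := by exact_mod_cast hb j
    gcongr
  have h3 : weight (fun i => d i.succ) (μ i) ≤ δ := by
    have h4 : ∀ h : Fin n, (μ i h : ℝ) / d h.succ ≤ μ i h * (δ / d 0) := by
      intro h
      have h5 := hdd 0 h.succ (Fin.succ_pos h)
      have h6 : (0 : ℝ) < d h.succ := by exact_mod_cast hd h.succ
      rw [div_eq_mul_inv]
      refine mul_le_mul_of_nonneg_left ?_ (Nat.cast_nonneg _)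
      rw [inv_eq_one_div, div_le_div_iff₀ h6 hd0]
      linarith
    refine (Finset.sum_le_sum fun h _ => h4 h).trans ?_
    rw [← Finset.sum_mul]
    have h7 : ∑ h, (μ i h : ℝ) ≤ d 0 := by
      have := (hμ i).trans (show (i : ℕ) ≤ d 0 by have := i.2; omega)
      exact_mod_cast this
    calc (∑ h, (μ i h : ℝ)) * (δ / d 0) ≤ d 0 * (δ / d 0) := by gcongr
      _ = δ := by field_simp
  linarith

end Step

/-- **Roth's lemma**: a nonzero integer polynomial with small coefficients has small index at a
rational point whose coordinates have rapidly varying denominators. -/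
theorem exists_weight_le_eval_hasse_ne_zero (n : ℕ) : ∀ ε > 0, ∃ δ > 0,
    ∀ (d : Fin n → ℕ) (p : Fin n → ℤ) (q : Fin n → ℕ) (L : ℝ) (P : MvPolynomial (Fin n) ℤ),
      RothData δ L d p q P → ∃ μ, weight d μ ≤ ε ∧
        eval (fun i => (p i : ℚ) / q i) (hasse μ (map (Int.castRingHom ℚ) P)) ≠ 0 := by
  induction n with
  | zero =>
    refine fun ε hε => ⟨1, one_pos, fun d p q L P hP => ⟨0, by simpa [weight] using hε.le, ?_⟩⟩
    have hc : coeff 0 P ≠ 0 := fun h0 => hP.ne_zero (by rw [eq_C_of_isEmpty P, h0, C_0])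
    rw [← coeff_translate, eq_C_of_isEmpty P, map_C, ← algebraMap_eq, AlgHom.commutes,
      algebraMap_eq, coeff_zero_C]
    simpa using hc
  | succ n ih =>
    intro ε hε
    set ε₁ := min ε 1
    have hε₁ : 0 < ε₁ := lt_min hε one_pos
    have hε₁1 : ε₁ ≤ 1 := min_le_right _ _
    obtain ⟨δ', hδ', ih⟩ := ih (ε₁ ^ 2 / 128) (by positivity)
    have hn : (0 : ℝ) < n + 4 := by positivity
    refine ⟨min (ε₁ / 2) (min δ' (ε₁ ^ 2 / 128) / (n + 4)), by positivity,
      fun d p q L P hP => ?_⟩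
    set δ := min (ε₁ / 2) (min δ' (ε₁ ^ 2 / 128) / (n + 4))
    have hδ0 : 0 < δ := by positivity
    have hδ1 : δ ≤ ε₁ / 2 := min_le_left _ _
    have hδ2 : (n + 4) * δ ≤ min δ' (ε₁ ^ 2 / 128) := by
      rw [← le_div_iff₀' hn]
      exact min_le_right _ _
    by_contra! hcon
    obtain ⟨k, b, μ, V, U, hk0, hk, hb, hμ, hV, hU, hW⟩ :=
      exists_map_det_hasse_eq_mul hP.ne_zero (hP.degreeOf_le 0)
    have hW0 : (Matrix.of fun i j => hasse (Finsupp.cons (b j) (μ i)) P).det ≠ 0 := by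
      obtain ⟨U', c, _, hU'0, _, hU'l⟩ := exists_map_eq_C_mul_rest hW hV hU
      intro h0
      have := (one_le_length hU'0).trans hU'l
      rw [h0, length_zero] at this
      omega
    have hidx := indexGE_wronskian hδ0 hδ1 hε₁ hε₁1 hP.degree_pos hP.degree_le_mul hk hb hμ
      (P := P) (x := fun i => (p i : ℚ) / q i)
      fun ν hν => hcon ν (hν.le.trans (min_le_left _ _))
    have hlen := log_length_det_hasse_le hk0 hk hP.ne_zero hP.degreeOf_le
      (fun i j => Finsupp.cons (b j) (μ i)) hW0
    obtain ⟨ν, hν, hν0⟩ := exists_eval_hasse_wronskian_ne_zero hδ0 (hδ2.trans (min_le_left _ _))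
      (hδ2.trans (min_le_right _ _)) hP ih hk0 hW hV hU
      (fun i => degreeOf_det_le _ i fun _ _ => (degreeOf_hasse_le _ _ i).trans (hP.degreeOf_le i))
      (hlen.trans (by
        have h1 := hP.degree_le 0
        have h2 : ∑ i, (d i : ℝ) ≤ (n + 1) * (δ * L) :=
          (Finset.sum_le_sum fun i _ => hP.degree_le i).trans (by simp)
        have h3 := hP.log_length_le
        gcongr
        linarith))
    refine hν0 (hidx ν (hν.trans_lt ?_))
    have : (0 : ℝ) < k := by exact_mod_cast hk0
    have : 0 < k * ε₁ ^ 2 := by positivity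
    linarith

end RothTheorem

namespace RothTheorem

section Counting

lemma sum_exp_le {d : ℕ} (hd : 0 < d) (l : ℝ) :
    ∑ j ∈ Finset.range (d + 1), Real.exp (l * (1 / 2 - j / d)) ≤
      (d + 1) * Real.exp (l ^ 2 / 8) := by
  have hd' : (0 : ℝ) < d := by exact_mod_cast hd
  have hrefl : ∑ j ∈ Finset.range (d + 1), Real.exp (l * (1 / 2 - j / d)) =
      ∑ j ∈ Finset.range (d + 1), Real.exp (-(l * (1 / 2 - j / d))) := by
    rw [← Finset.sum_range_reflect]
    refine Finset.sum_congr rfl fun j hj => ?_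
    have hj' : j ≤ d := Nat.lt_succ_iff.mp (Finset.mem_range.mp hj)
    rw [show d + 1 - 1 - j = d - j by omega, Nat.cast_sub hj']
    congr 1
    field_simp
    ring
  have hcosh : ∑ j ∈ Finset.range (d + 1), Real.exp (l * (1 / 2 - j / d)) =
      ∑ j ∈ Finset.range (d + 1), Real.cosh (l * (1 / 2 - j / d)) := by
    simp_rw [Real.cosh_eq, ← Finset.sum_div, Finset.sum_add_distrib, ← hrefl]
    ring
  rw [hcosh]
  have h : ∀ j ∈ Finset.range (d + 1), Real.cosh (l * (1 / 2 - j / d)) ≤ Real.exp (l ^ 2 / 8) := by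
    intro j hj
    have hj' : (j : ℝ) ≤ d := by exact_mod_cast Nat.lt_succ_iff.mp (Finset.mem_range.mp hj)
    refine (Real.cosh_le_exp_half_sq _).trans (Real.exp_le_exp.mpr ?_)
    have h0 : (0 : ℝ) ≤ j / d := by positivity
    have h1 : (j : ℝ) / d ≤ 1 := (div_le_one hd').mpr hj'
    have h2 : (1 / 2 - (j : ℝ) / d) ^ 2 ≤ 1 / 4 := by nlinarith
    rw [mul_pow]
    nlinarith [sq_nonneg l]
  refine (Finset.sum_le_sum h).trans (le_of_eq ?_)
  simp

/-- A large deviation bound for the number of multi-indices of small weight in a box. -/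
lemma card_sum_div_lt_le {m : ℕ} {d : Fin m → ℕ} (hd : ∀ i, 0 < d i) {ε : ℝ} (hε : 0 < ε) :
    (((Fintype.piFinset fun i => Finset.range (d i + 1)).filter
      fun ν => ∑ i, (ν i : ℝ) / d i < m * (1 / 2 - ε)).card : ℝ) ≤
      Real.exp (-(2 * ε ^ 2 * m)) * ∏ i, ((d i : ℝ) + 1) := by
  set B := Fintype.piFinset fun i => Finset.range (d i + 1)
  calc ((B.filter fun ν => ∑ i, (ν i : ℝ) / d i < m * (1 / 2 - ε)).card : ℝ)
      = ∑ ν ∈ B.filter (fun ν => ∑ i, (ν i : ℝ) / d i < m * (1 / 2 - ε)), 1 := by simp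
    _ ≤ ∑ ν ∈ B.filter (fun ν => ∑ i, (ν i : ℝ) / d i < m * (1 / 2 - ε)),
        Real.exp (4 * ε * (m * (1 / 2 - ε) - ∑ i, (ν i : ℝ) / d i)) := by
      refine Finset.sum_le_sum fun ν hν => Real.one_le_exp ?_
      have := (Finset.mem_filter.mp hν).2
      exact mul_nonneg (by positivity) (by linarith)
    _ ≤ ∑ ν ∈ B, Real.exp (4 * ε * (m * (1 / 2 - ε) - ∑ i, (ν i : ℝ) / d i)) :=
      Finset.sum_le_sum_of_subset_of_nonneg (Finset.filter_subset _ _)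
        fun _ _ _ => (Real.exp_pos _).le
    _ = ∑ ν ∈ B, Real.exp (-(4 * ε ^ 2 * m)) *
        ∏ i, Real.exp (4 * ε * (1 / 2 - (ν i : ℝ) / d i)) := by
      refine Finset.sum_congr rfl fun ν _ => ?_
      rw [← Real.exp_sum, ← Real.exp_add, ← Finset.mul_sum, Finset.sum_sub_distrib]
      congr 1
      simp only [Finset.sum_const, Finset.card_univ, Fintype.card_fin, nsmul_eq_mul]
      ring
    _ = Real.exp (-(4 * ε ^ 2 * m)) *
        ∏ i, ∑ j ∈ Finset.range (d i + 1), Real.exp (4 * ε * (1 / 2 - (j : ℝ) / d i)) := by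
      rw [← Finset.mul_sum, Finset.prod_univ_sum]
    _ ≤ Real.exp (-(4 * ε ^ 2 * m)) * ∏ i, (((d i : ℝ) + 1) * Real.exp ((4 * ε) ^ 2 / 8)) := by
      refine mul_le_mul_of_nonneg_left (Finset.prod_le_prod
        (fun i _ => Finset.sum_nonneg fun _ _ => (Real.exp_pos _).le)
        fun i _ => sum_exp_le (hd i) _) (Real.exp_pos _).le
    _ = _ := by
      rw [Finset.prod_mul_distrib, Finset.prod_const, ← Real.exp_nat_mul, mul_left_comm,
        ← Real.exp_add, mul_comm]
      congr 2
      simp only [Finset.card_univ, Fintype.card_fin]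
      ring

end Counting

section Powers

/-- Integral coordinates of the powers of an algebraic integer grow at most exponentially. -/
lemma exists_pow_eq_sum {α : ℝ} (hα : IsIntegral ℤ α) :
    ∃ D A : ℕ, 0 < D ∧ 0 < A ∧ ∀ j : ℕ, ∃ c : Fin D → ℤ, (∀ s, |c s| ≤ (A : ℤ) ^ j) ∧
      α ^ j = ∑ s, (c s : ℝ) * α ^ (s : ℕ) := by
  obtain ⟨f, hf, hfα⟩ := hα
  obtain ⟨D, hD⟩ : ∃ D, f.natDegree = D + 1 := by
    refine Nat.exists_eq_succ_of_ne_zero fun h0 => ?_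
    rw [hf.natDegree_eq_zero.mp h0] at hfα
    simp at hfα
  have hg : α ^ (D + 1) = ∑ s : Fin (D + 1), (-f.coeff s : ℝ) * α ^ (s : ℕ) := by
    rw [Polynomial.eval₂_eq_sum_range, hD, Finset.sum_range_succ, ← hD, hf.coeff_natDegree, hD]
      at hfα
    rw [Fin.sum_univ_eq_sum_range fun s => (-f.coeff s : ℝ) * α ^ s]
    simp only [neg_mul, Finset.sum_neg_distrib]
    simp at hfα
    linarith
  set H : ℕ := ∑ s : Fin (D + 1), (f.coeff s).natAbs with hH
  have hfH : ∀ s : Fin (D + 1), |f.coeff s| ≤ H := by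
    intro s
    rw [Int.abs_eq_natAbs]
    exact_mod_cast Finset.single_le_sum (f := fun s : Fin (D + 1) => (f.coeff s).natAbs)
      (fun _ _ => Nat.zero_le _) (Finset.mem_univ s)
  refine ⟨D + 1, H + 1, Nat.succ_pos _, Nat.succ_pos _, fun j => ?_⟩
  induction j with
  | zero =>
    refine ⟨Pi.single 0 1, fun s => ?_, ?_⟩
    · rcases eq_or_ne s 0 with rfl | hs <;> simp [*]
    · simp [Fin.sum_univ_succ]
  | succ j ih =>
    obtain ⟨c, hc, hcj⟩ := ih
    refine ⟨fun s => (Fin.cons 0 fun i => c (Fin.castSucc i) : Fin (D + 1) → ℤ) s -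
      c (Fin.last D) * f.coeff s, fun s => ?_, ?_⟩
    · have h1 : |(Fin.cons 0 fun i => c (Fin.castSucc i) : Fin (D + 1) → ℤ) s| ≤
          ((H + 1 : ℕ) : ℤ) ^ j := by
        refine Fin.cases ?_ (fun i => ?_) s
        · simp only [Fin.cons_zero, abs_zero]; positivity
        · simpa using hc _
      refine (abs_sub _ _).trans ?_
      rw [abs_mul, pow_succ]
      have h2 := mul_le_mul (hc (Fin.last D)) (hfH s) (abs_nonneg _) (by positivity)
      push_cast at *
      linarith
    · rw [pow_succ, hcj, Finset.sum_mul, Fin.sum_univ_castSucc]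
      simp only [Int.cast_sub, Int.cast_mul, sub_mul, Finset.sum_sub_distrib, mul_assoc,
        ← Finset.mul_sum, Fin.val_castSucc, Fin.val_last, ← pow_succ, hg]
      rw [Fin.sum_univ_succ (f := fun s => (((Fin.cons 0 fun i => c (Fin.castSucc i) :
        Fin (D + 1) → ℤ) s : ℤ) : ℝ) * α ^ (s : ℕ))]
      simp [Finset.mul_sum]
      ring

end Powers

end RothTheorem

namespace RothTheorem

open MvPolynomial

section Siegel

attribute [local instance] Matrix.seminormedAddCommGroup

/-- Siegel's lemma for systems with at least twice as many unknowns as equations. -/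
lemma exists_mulVec_eq_zero_abs_le {ι κ : Type*} [Fintype ι] [Fintype κ] (M : Matrix ι κ ℤ)
    {B : ℝ} (hB : 1 ≤ B) (hM : ∀ i j, |(M i j : ℝ)| ≤ B) (hι : 0 < Fintype.card ι)
    (hικ : 2 * Fintype.card ι ≤ Fintype.card κ) :
    ∃ t : κ → ℤ, t ≠ 0 ∧ M.mulVec t = 0 ∧ ∀ j, |(t j : ℝ)| ≤ Fintype.card κ * B := by
  obtain ⟨t, ht0, ht, htn⟩ := Int.Matrix.exists_ne_zero_int_vec_norm_le M (by omega) hι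
  refine ⟨t, ht0, ht, fun j => ?_⟩
  have hι' : (0 : ℝ) < Fintype.card ι := by exact_mod_cast hι
  have hικ' : (2 : ℝ) * Fintype.card ι ≤ Fintype.card κ := by exact_mod_cast hικ
  have hκ1 : (1 : ℝ) ≤ Fintype.card κ := by
    have : 1 ≤ Fintype.card κ := by omega
    exact_mod_cast this
  have hMB : max 1 ‖M‖ ≤ B := max_le hB ((Matrix.norm_le_iff (by linarith)).mpr fun i j => by
    simpa [Int.norm_eq_abs] using hM i j)
  have h1 : |(t j : ℝ)| ≤ ‖t‖ := by
    rw [← Int.norm_eq_abs]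
    exact norm_le_pi_norm t j
  refine h1.trans (htn.trans ?_)
  have h2 : (1 : ℝ) ≤ Fintype.card κ * max 1 ‖M‖ :=
    one_le_mul_of_one_le_of_one_le hκ1 (le_max_left _ _)
  refine (Real.rpow_le_rpow_of_exponent_le h2 (y := _) (z := 1) ?_).trans ?_
  · rw [div_le_one (by linarith)]
    linarith
  · rw [Real.rpow_one]
    gcongr

end Siegel

section Auxiliary

lemma eval_const_hasse_monomial {m : ℕ} (α : ℝ) (μ ν : Fin m →₀ ℕ) (c : ℝ) :
    eval (fun _ => α) (hasse μ (monomial ν c)) =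
      c * multichoose ν μ * α ^ ∑ i, (ν i - μ i) := by
  rw [hasse_monomial, eval_monomial, Finsupp.prod_fintype _ _ (by simp), Finset.prod_pow_eq_pow_sum]
  rfl

/-- The multi-indices bounded by `d`. -/
def box {m : ℕ} (d : Fin m → ℕ) : Finset (Fin m → ℕ) :=
  Fintype.piFinset fun i => Finset.range (d i + 1)

lemma card_box {m : ℕ} (d : Fin m → ℕ) : (box d).card = ∏ i, (d i + 1) := by
  simp [box]

lemma le_of_mem_box {m : ℕ} {d ν : Fin m → ℕ} (h : ν ∈ box d) (i : Fin m) : ν i ≤ d i :=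
  Nat.lt_succ_iff.mp (Finset.mem_range.mp (Fintype.mem_piFinset.mp h i))

/-- The auxiliary polynomial: an integer polynomial with small coefficients and large index at
the diagonal point `(α, …, α)`. -/
theorem exists_length_le_indexGE {α : ℝ} (hα : IsIntegral ℤ α) :
    ∃ D A : ℕ, 0 < D ∧ 0 < A ∧ ∀ (m : ℕ) (ε : ℝ), 0 < m → 0 < ε → ε < 1 / 2 →
      2 * D * Real.exp (-(2 * ε ^ 2 * m)) ≤ 1 → ∀ d : Fin m → ℕ, (∀ i, 0 < d i) →
        ∃ P : MvPolynomial (Fin m) ℤ, P ≠ 0 ∧ (∀ i, degreeOf i P ≤ d i) ∧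
          (length P : ℝ) ≤ A ^ ∑ i, d i ∧
          IndexGE d (fun _ => α) (m * (1 / 2 - ε)) (map (Int.castRingHom ℝ) P) := by
  classical
  obtain ⟨D, A, hD, hA, hc⟩ := exists_pow_eq_sum hα
  choose c hc hcα using hc
  refine ⟨D, 8 * A, hD, by positivity, fun m ε hm hε hε2 hDε d hd => ?_⟩
  set S := (box d).filter fun ν => ∑ i, (ν i : ℝ) / d i < m * (1 / 2 - ε) with hS
  let e : (Fin m → ℕ) ≃ (Fin m →₀ ℕ) := Finsupp.equivFunOnFinite.symm
  let M : Matrix (S × Fin D) (box d) ℤ := Matrix.of fun x ν =>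
    multichoose (e ν) (e x.1) * c (∑ i, (ν.1 i - x.1.1 i)) x.2
  set T := ∑ i, d i with hT
  have hA1 : (1 : ℝ) ≤ A := by exact_mod_cast hA
  have hbox : ∀ {ν : Fin m → ℕ}, ν ∈ box d → ∑ i, ν i ≤ T := fun h =>
    Finset.sum_le_sum fun i _ => le_of_mem_box h i
  have hM : ∀ x ν, |(M x ν : ℝ)| ≤ (2 * A) ^ T := by
    intro x ν
    simp only [M, Matrix.of_apply, Int.cast_mul, abs_mul, Int.cast_natCast, Nat.abs_cast, mul_pow]
    have h1 : (multichoose (e ν) (e x.1) : ℝ) ≤ 2 ^ T := by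
      exact_mod_cast (multichoose_le _ _).trans (Nat.pow_le_pow_right two_pos (hbox ν.2))
    have h2 : |(c (∑ i, (ν.1 i - x.1.1 i)) x.2 : ℝ)| ≤ A ^ T := by
      have h3 : |(c (∑ i, (ν.1 i - x.1.1 i)) x.2 : ℝ)| ≤ A ^ (∑ i, (ν.1 i - x.1.1 i)) := by
        exact_mod_cast hc _ _
      exact h3.trans (pow_le_pow_right₀ hA1
        ((Finset.sum_le_sum fun i _ => Nat.sub_le _ _).trans (hbox ν.2)))
    gcongr
  have hcard : 2 * Fintype.card (S × Fin D) ≤ Fintype.card (box d) := by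
    have h1 := card_sum_div_lt_le hd hε
    change (S.card : ℝ) ≤ _ at h1
    rw [Fintype.card_prod, Fintype.card_coe, Fintype.card_coe, Fintype.card_fin]
    have h2 : ((box d).card : ℝ) = ∏ i, ((d i : ℝ) + 1) := by
      rw [card_box]; push_cast; rfl
    rw [← h2] at h1
    have h3 : (2 * (S.card * D) : ℝ) ≤ (box d).card := by
      calc (2 * (S.card * D) : ℝ)
          ≤ 2 * (Real.exp (-(2 * ε ^ 2 * m)) * (box d).card * D) := by gcongr
        _ = 2 * D * Real.exp (-(2 * ε ^ 2 * m)) * (box d).card := by ring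
        _ ≤ 1 * (box d).card := by gcongr
        _ = _ := one_mul _
    exact_mod_cast h3
  have hSpos : 0 < Fintype.card (S × Fin D) := by
    have : (0 : Fin m → ℕ) ∈ S := by
      rw [hS, Finset.mem_filter]
      have : (0 : ℝ) < m := by exact_mod_cast hm
      refine ⟨by simp [box], ?_⟩
      simp only [Pi.zero_apply, Nat.cast_zero, zero_div, Finset.sum_const_zero]
      exact mul_pos this (by linarith)
    rw [Fintype.card_prod, Fintype.card_coe, Fintype.card_fin]
    exact Nat.mul_pos (Finset.card_pos.mpr ⟨_, this⟩) hD
  obtain ⟨t, ht0, ht, htB⟩ := exists_mulVec_eq_zero_abs_le M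
    (one_le_pow₀ (by linarith)) hM hSpos hcard
  set P : MvPolynomial (Fin m) ℤ := ∑ ν : box d, monomial (e ν) (t ν) with hP
  have hcoeff : ∀ ν : box d, coeff (e ν) P = t ν := by
    intro ν
    rw [hP, coeff_sum, Finset.sum_eq_single ν]
    · simp
    · intro κ _ hκ
      rw [coeff_monomial, if_neg fun h => hκ (Subtype.ext (e.injective h))]
    · simp
  refine ⟨P, ?_, fun i => ?_, ?_, fun μ hμ => ?_⟩
  · obtain ⟨ν, hν⟩ := Function.ne_iff.mp ht0
    exact fun h0 => hν (by rw [← hcoeff, h0]; rfl)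
  · refine (degreeOf_sum_le _ _ _).trans (Finset.sup_le fun ν _ => ?_)
    refine degreeOf_le_iff.mpr fun κ hκ => ?_
    rw [Finset.mem_singleton.mp (support_monomial_subset hκ)]
    exact le_of_mem_box ν.2 i
  · have h1 : (length P : ℝ) ≤ ∑ ν : box d, |(t ν : ℝ)| := by
      have := length_sum_le Finset.univ fun ν : box d => monomial (e ν) (t ν)
      simp only [length_monomial] at this
      exact_mod_cast this
    have h2 : ((box d).card : ℝ) ≤ 2 ^ T := by
      have : (box d).card ≤ 2 ^ T := by
        rw [card_box, hT, ← Finset.prod_pow_eq_pow_sum]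
        exact Finset.prod_le_prod' fun i _ => Nat.lt_two_pow_self
      exact_mod_cast this
    refine h1.trans ((Finset.sum_le_sum fun ν _ => htB ν).trans ?_)
    rw [Finset.sum_const, Finset.card_univ, Fintype.card_coe, nsmul_eq_mul]
    calc ((box d).card : ℝ) * ((box d).card * (2 * A) ^ T) ≤ 2 ^ T * (2 ^ T * (2 * A) ^ T) := by
          gcongr
      _ = _ := by
        rw [← mul_pow, ← mul_pow]
        push_cast
        congr 1
        ring
  · rw [hP]
    simp only [map_sum, map_monomial, eval_const_hasse_monomial]
    by_cases hμd : μ ∈ Set.range fun x : S => e x.1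
    · obtain ⟨x, rfl⟩ := hμd
      have h1 : ∀ s, ∑ ν, (M (x, s) ν : ℝ) * t ν = 0 := by
        intro s
        have := congrFun ht (x, s)
        simp only [Matrix.mulVec, dotProduct, Pi.zero_apply] at this
        exact_mod_cast this
      calc _ = ∑ ν : box d, ∑ s, (M (x, s) ν : ℝ) * t ν * α ^ (s : ℕ) := by
            refine Finset.sum_congr rfl fun ν _ => ?_
            change (t ν : ℝ) * multichoose (e ν) (e x) * α ^ ∑ i, (ν.1 i - x.1 i) = _
            rw [hcα, Finset.mul_sum]
            refine Finset.sum_congr rfl fun s _ => ?_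
            simp only [M, Matrix.of_apply]
            push_cast
            ring
        _ = 0 := by
            rw [Finset.sum_comm]
            simp only [← Finset.sum_mul, h1, zero_mul, Finset.sum_const_zero]
    · refine Finset.sum_eq_zero fun ν _ => ?_
      rw [multichoose_eq_zero, Nat.cast_zero, mul_zero, zero_mul]
      intro hle
      refine hμd ⟨⟨e.symm μ, ?_⟩, e.apply_symm_apply μ⟩
      rw [hS, Finset.mem_filter]
      refine ⟨Fintype.mem_piFinset.mpr fun i => Finset.mem_range.mpr
        (Nat.lt_succ_iff.mpr ((hle i).trans (le_of_mem_box ν.2 i))), hμ⟩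

end Auxiliary

end RothTheorem

namespace RothTheorem

open MvPolynomial

section Estimates

variable {m : ℕ} {d : Fin m → ℕ} {P : MvPolynomial (Fin m) ℤ}

lemma hasse_eq_zero {R : Type*} [CommRing R] {P : MvPolynomial (Fin m) R}
    (hP : ∀ i, degreeOf i P ≤ d i) {ν : Fin m →₀ ℕ} (hν : ¬ ∀ i, ν i ≤ d i) : hasse ν P = 0 := by
  rw [P.as_sum, map_sum]
  refine Finset.sum_eq_zero fun κ hκ => ?_
  rw [hasse_monomial, multichoose_eq_zero, Nat.cast_zero, mul_zero, monomial_zero]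
  exact fun hle => hν fun i => (hle i).trans (degreeOf_le_iff.mp (hP i) κ hκ)

lemma abs_eval_const_le (α : ℝ) (hP : ∀ i, degreeOf i P ≤ d i) :
    |eval (fun _ => α) (map (Int.castRingHom ℝ) P)| ≤ length P * (1 + |α|) ^ ∑ i, d i := by
  have h1 : (1 : ℝ) ≤ 1 + |α| := by linarith [abs_nonneg α]
  rw [eval_map, eval₂_eq']
  refine (Finset.abs_sum_le_sum_abs _ _).trans ?_
  rw [length_eq_of_subset subset_rfl, Int.cast_sum, Finset.sum_mul]
  refine Finset.sum_le_sum fun ν hν => ?_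
  rw [abs_mul, Finset.prod_pow_eq_pow_sum, abs_pow, eq_intCast, Int.cast_abs]
  refine mul_le_mul_of_nonneg_left ?_ (abs_nonneg _)
  exact (pow_le_pow_left₀ (abs_nonneg _) (by linarith) _).trans (pow_le_pow_right₀ h1
    (Finset.sum_le_sum fun i _ => degreeOf_le_iff.mp (hP i) ν hν))

/-- A polynomial of large index at `(α, …, α)` is small at nearby points. -/
lemma abs_eval_le_of_indexGE {α c L s : ℝ} (hc : 0 ≤ c * L) (hP : ∀ i, degreeOf i P ≤ d i)
    (hs : IndexGE d (fun _ => α) s (map (Int.castRingHom ℝ) P)) {x : Fin m → ℝ}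
    (hx : ∀ i, |x i - α| ≤ Real.exp (-(c * L / d i))) :
    |eval x (map (Int.castRingHom ℝ) P)| ≤
      (4 * (1 + |α|)) ^ (∑ i, d i) * length P * Real.exp (-(c * L * s)) := by
  classical
  set T := ∑ i, d i with hT
  set Q := translate (fun _ => α) (map (Int.castRingHom ℝ) P) with hQ
  have hPR : ∀ i, degreeOf i (map (Int.castRingHom ℝ) P) ≤ d i := fun i =>
    degreeOf_le_iff.mpr fun ν hν => degreeOf_le_iff.mp (hP i) ν (support_map_subset _ _ hν)
  have heval : eval x (map (Int.castRingHom ℝ) P) = eval (fun i => x i - α) Q := by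
    rw [hQ, eval_translate]
    congr 2
    ext i
    simp
  have hlen0 : (0 : ℝ) ≤ length P := by exact_mod_cast length_nonneg P
  have hcoeff : ∀ ν, |coeff ν Q| ≤ 2 ^ T * length P * (1 + |α|) ^ T := by
    intro ν
    rw [hQ, coeff_translate, ← map_hasse]
    refine (abs_eval_const_le α fun i => (degreeOf_hasse_le ν P i).trans (hP i)).trans ?_
    have : (length (hasse ν P) : ℝ) ≤ 2 ^ T * length P := by exact_mod_cast length_hasse_le ν P hP
    gcongr
  have hsupp : Q.support.card ≤ 2 ^ T := by
    have h1 : Q.support.card ≤ (box d).card := by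
      refine Finset.card_le_card_of_injOn (fun ν => ⇑ν) (fun ν hν => ?_)
        DFunLike.coe_injective.injOn
      have h2 : ∀ i, ν i ≤ d i := by
        by_contra h3
        rw [Finset.mem_coe, mem_support_iff, hQ, coeff_translate, hasse_eq_zero hPR h3,
          map_zero] at hν
        exact hν rfl
      exact Fintype.mem_piFinset.mpr fun i => Finset.mem_range.mpr (Nat.lt_succ_iff.mpr (h2 i))
    refine h1.trans ?_
    rw [card_box, hT, ← Finset.prod_pow_eq_pow_sum]
    exact Finset.prod_le_prod' fun i _ => Nat.lt_two_pow_self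
  have hterm : ∀ ν ∈ Q.support, |coeff ν Q * ∏ i, (x i - α) ^ ν i| ≤
      2 ^ T * length P * (1 + |α|) ^ T * Real.exp (-(c * L * s)) := by
    intro ν hν
    have hw : s ≤ weight d ν := by
      by_contra! h
      rw [mem_support_iff, hQ, coeff_translate] at hν
      exact hν (hs ν h)
    rw [abs_mul, Finset.abs_prod]
    refine mul_le_mul (hcoeff ν) ?_ (Finset.prod_nonneg fun _ _ => abs_nonneg _) (by positivity)
    calc ∏ i, |(x i - α) ^ ν i| ≤ ∏ i, Real.exp (-(c * L / d i)) ^ ν i := by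
          refine Finset.prod_le_prod (fun _ _ => abs_nonneg _) fun i _ => ?_
          rw [abs_pow]
          exact pow_le_pow_left₀ (abs_nonneg _) (hx i) _
      _ = Real.exp (-(c * L * weight d ν)) := by
          simp_rw [← Real.exp_nat_mul]
          rw [← Real.exp_sum, weight, Finset.mul_sum, ← Finset.sum_neg_distrib]
          congr 1
          exact Finset.sum_congr rfl fun i _ => by ring
      _ ≤ _ := Real.exp_le_exp.mpr (neg_le_neg (mul_le_mul_of_nonneg_left hw hc))
  rw [heval, eval_eq']
  refine (Finset.abs_sum_le_sum_abs _ _).trans ((Finset.sum_le_sum hterm).trans ?_)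
  rw [Finset.sum_const, nsmul_eq_mul]
  have hsupp' : (Q.support.card : ℝ) ≤ 2 ^ T := by exact_mod_cast hsupp
  calc _ ≤ 2 ^ T * (2 ^ T * length P * (1 + |α|) ^ T * Real.exp (-(c * L * s))) := by gcongr
    _ = _ := by
      rw [mul_pow, show (4 : ℝ) = 2 * 2 by norm_num, mul_pow]
      ring

/-- A nonzero value of an integer polynomial at a rational point is bounded below. -/
lemma one_le_abs_eval_mul_prod (hP : ∀ i, degreeOf i P ≤ d i) {p : Fin m → ℤ} {q : Fin m → ℕ}
    (hq : ∀ i, 0 < q i)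
    (h0 : eval (fun i => (p i : ℚ) / q i) (map (Int.castRingHom ℚ) P) ≠ 0) :
    1 ≤ |eval (fun i => (p i : ℝ) / q i) (map (Int.castRingHom ℝ) P)| *
      ∏ i, (q i : ℝ) ^ d i := by
  have hcast : ((eval (fun i => (p i : ℚ) / q i) (map (Int.castRingHom ℚ) P) : ℚ) : ℝ) =
      eval (fun i => (p i : ℝ) / q i) (map (Int.castRingHom ℝ) P) := by
    simp [eval_map, eval₂_eq']
  have hqR : ∀ i, (0 : ℝ) < q i := fun i => by exact_mod_cast hq i
  have hprod : 0 < ∏ i, (q i : ℝ) ^ d i := Finset.prod_pos fun i _ => pow_pos (hqR i) _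
  have hint : eval (fun i => (p i : ℝ) / q i) (map (Int.castRingHom ℝ) P) *
      ∏ i, (q i : ℝ) ^ d i =
      ((∑ ν ∈ P.support, coeff ν P * ∏ i, (p i ^ ν i * (q i : ℤ) ^ (d i - ν i)) : ℤ) : ℝ) := by
    rw [eval_map, eval₂_eq', Finset.sum_mul]
    push_cast
    refine Finset.sum_congr rfl fun ν hν => ?_
    rw [eq_intCast, mul_assoc, ← Finset.prod_mul_distrib]
    congr 1
    refine Finset.prod_congr rfl fun i _ => ?_
    have hle := degreeOf_le_iff.mp (hP i) ν hν
    have := (hqR i).ne'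
    rw [← Nat.sub_add_cancel hle, pow_add, div_pow]
    simp only [Nat.add_sub_cancel]
    field_simp
  have hne : eval (fun i => (p i : ℝ) / q i) (map (Int.castRingHom ℝ) P) ≠ 0 := by
    rw [← hcast]
    exact_mod_cast h0
  have h1 := mul_ne_zero hne hprod.ne'
  rw [← abs_of_pos hprod, ← abs_mul]
  rw [hint] at h1 ⊢
  exact_mod_cast Int.one_le_abs (by exact_mod_cast h1)

end Estimates

end RothTheorem

namespace RothTheorem

open MvPolynomial

/-- Good approximations can be chosen with denominators growing as fast as desired. -/
lemma exists_rapid_sequence {S : ℤ → ℕ → Prop} (h : ∀ N, ∃ p q, N < q ∧ S p q) (N K m : ℕ) :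
    ∃ (p : Fin m → ℤ) (q : Fin m → ℕ), (∀ i, N < q i ∧ S (p i) (q i)) ∧
      ∀ i j, i < j → q j ^ K ≤ q i := by
  induction m with
  | zero => exact ⟨fun _ => 0, fun _ => 0, fun i => i.elim0, fun i => i.elim0⟩
  | succ m ih =>
    obtain ⟨p, q, hq, hqq⟩ := ih
    obtain ⟨p₀, q₀, hq₀, hS⟩ := h (N + ∑ j, q j ^ K)
    refine ⟨Fin.cons p₀ p, Fin.cons q₀ q, Fin.cases ⟨by simp; omega, by simpa⟩ (by simpa),
      fun i j hij => ?_⟩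
    obtain ⟨j, rfl⟩ := Fin.exists_succ_eq.mpr (Fin.ne_zero_of_lt hij)
    refine Fin.cases (fun _ => ?_) (fun i hij => ?_) i hij
    · simp only [Fin.cons_succ, Fin.cons_zero]
      have := Finset.single_le_sum (f := fun j => q j ^ K) (fun _ _ => Nat.zero_le _)
        (Finset.mem_univ j)
      omega
    · simpa using hqq i j (Fin.succ_lt_succ_iff.mp hij)

/-- Degrees adapted to a sequence of denominators with logarithms `l`. -/
lemma exists_degrees {m : ℕ} (hm : 0 < m) {δ κ η : ℝ} (hδ : 0 < δ) (hκ : 0 < κ) (hη : 0 < η)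
    {l : Fin m → ℝ} (hl : ∀ i, 2 / κ ≤ l i) (hll : ∀ i j, i < j → 2 / δ * l j ≤ l i) :
    ∃ (L : ℝ) (d : Fin m → ℕ), 0 < L ∧ (∀ i, 0 < d i) ∧ (∀ i j, i < j → (d i : ℝ) ≤ δ * d j) ∧
      (∀ i, (d i : ℝ) ≤ κ * L) ∧ (∀ i, L ≤ d i * l i) ∧ ∀ i, d i * l i ≤ (1 + η) * L := by
  have hl0 : ∀ i, 0 < l i := fun i => lt_of_lt_of_le (by positivity) (hl i)
  have hsum : ∀ i, l i ≤ ∑ j, l j := fun i =>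
    Finset.single_le_sum (fun j _ => (hl0 j).le) (Finset.mem_univ i)
  set L := (1 + 1 / η) * ∑ j, l j with hLdef
  have hS : 0 < ∑ j, l j := (hl0 ⟨0, hm⟩).trans_le (hsum _)
  have hL : 0 < L := by positivity
  have hL1 : ∀ i, l i ≤ L := fun i => by
    have : 0 ≤ 1 / η * ∑ j, l j := by positivity
    have := hsum i
    rw [hLdef]
    linarith
  have hL2 : ∀ i, l i ≤ η * L := fun i => by
    have h1 := hsum i
    have h2 : η * L = η * (∑ j, l j) + ∑ j, l j := by
      rw [hLdef]
      field_simp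
    have : 0 ≤ η * ∑ j, l j := by positivity
    linarith
  have hlow : ∀ i, L ≤ (⌈L / l i⌉₊ : ℝ) * l i := fun i => by
    rw [← div_le_iff₀ (hl0 i)]
    exact Nat.le_ceil _
  have hup : ∀ i, (⌈L / l i⌉₊ : ℝ) * l i ≤ L + l i := fun i => by
    have h1 := (Nat.ceil_lt_add_one (div_pos hL (hl0 i)).le).le
    calc (⌈L / l i⌉₊ : ℝ) * l i ≤ (L / l i + 1) * l i :=
          mul_le_mul_of_nonneg_right h1 (hl0 i).le
      _ = _ := by
        have := (hl0 i).ne'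
        field_simp
  refine ⟨L, fun i => ⌈L / l i⌉₊, hL, fun i => Nat.ceil_pos.mpr (div_pos hL (hl0 i)),
    fun i j hij => ?_, fun i => ?_, hlow, fun i => ?_⟩
  · have h1 := mul_le_mul_of_nonneg_left (hll i j hij) (Nat.cast_nonneg (α := ℝ) ⌈L / l i⌉₊)
    have h2 : (⌈L / l i⌉₊ : ℝ) * (2 / δ) * l j ≤ 2 * ⌈L / l j⌉₊ * l j := by
      linarith [hup i, hL1 i, hlow j]
    have h3 := le_of_mul_le_mul_right h2 (hl0 j)
    rw [mul_div_assoc', div_le_iff₀ hδ] at h3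
    linarith
  · have h1 := mul_le_mul_of_nonneg_left (hl i) (Nat.cast_nonneg (α := ℝ) ⌈L / l i⌉₊)
    have h2 : (⌈L / l i⌉₊ : ℝ) * (2 / κ) ≤ 2 * L := by linarith [hup i, hL1 i]
    rw [mul_div_assoc', div_le_iff₀ hκ] at h2
    linarith
  · linarith [hup i, hL2 i]

/-- The comparison of upper and lower bounds for the value of the auxiliary polynomial. -/
lemma not_exists_small_value {m : ℕ} (hm : 0 < m) {α r κ L s : ℝ} (hr : 0 < r) (hL : 0 < L)
    {A : ℕ} (hA : 0 < A) {d : Fin m → ℕ} {p : Fin m → ℤ} {q : Fin m → ℕ}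
    {P : MvPolynomial (Fin m) ℤ} (hq : ∀ i, 0 < q i) (hd : ∀ i, (d i : ℝ) ≤ κ * L)
    (hlow : ∀ i, L ≤ d i * Real.log (q i))
    (hup : ∀ i, d i * Real.log (q i) ≤ (1 + r / 8) * L)
    (hκ : κ * Real.log (8 * A * (1 + |α|)) ≤ r / 8)
    (hpq : ∀ i, |α - p i / q i| ≤ (q i : ℝ) ^ (-(2 + r)))
    (hP : ∀ i, degreeOf i P ≤ d i) (hlen : (length P : ℝ) ≤ (2 * A) ^ ∑ i, d i)
    (hs : m * (1 + 3 * r / 8) ≤ (2 + r) * s)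
    (hidx : IndexGE d (fun _ => α) s (map (Int.castRingHom ℝ) P))
    (h0 : eval (fun i => (p i : ℚ) / q i) (map (Int.castRingHom ℚ) P) ≠ 0) : False := by
  have hqR : ∀ i, (0 : ℝ) < q i := fun i => by exact_mod_cast hq i
  have hA1 : (1 : ℝ) ≤ A := by exact_mod_cast hA
  have hα := abs_nonneg α
  set K := 8 * A * (1 + |α|) with hK
  have hK1 : 1 < K := by nlinarith
  have hlogK : 0 < Real.log K := Real.log_pos hK1
  have hx : ∀ i, |(p i : ℝ) / q i - α| ≤ Real.exp (-((2 + r) * L / d i)) := by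
    intro i
    rw [abs_sub_comm]
    refine (hpq i).trans ?_
    rw [Real.rpow_def_of_pos (hqR i)]
    refine Real.exp_le_exp.mpr ?_
    have h1 : (2 + r) * L / d i ≤ (2 + r) * Real.log (q i) := by
      rw [mul_div_assoc]
      refine mul_le_mul_of_nonneg_left ?_ (by linarith)
      have hd0 : (0 : ℝ) < d i := by
        rcases Nat.eq_zero_or_pos (d i) with h | h
        · have := hlow i
          rw [h] at this
          simp only [Nat.cast_zero, zero_mul] at this
          linarith
        · exact_mod_cast h
      rw [div_le_iff₀ hd0]
      linarith [hlow i]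
    linarith
  have h1 := abs_eval_le_of_indexGE (c := 2 + r) (L := L) (by positivity) hP hidx hx
  have h2 := one_le_abs_eval_mul_prod hP hq h0
  set T := ∑ i, d i with hT
  have h3 : (4 * (1 + |α|)) ^ T * length P ≤ K ^ T := by
    calc (4 * (1 + |α|)) ^ T * length P ≤ (4 * (1 + |α|)) ^ T * (2 * A) ^ T := by gcongr
      _ = K ^ T := by
        rw [← mul_pow, hK]
        congr 1
        ring
  have hTL : (T : ℝ) ≤ m * (κ * L) := by
    rw [hT, Nat.cast_sum]
    exact (Finset.sum_le_sum fun i _ => hd i).trans (by simp)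
  have h4 : K ^ T ≤ Real.exp (m * L * (r / 8)) := by
    rw [← Real.exp_log (by linarith : (0 : ℝ) < K), ← Real.exp_nat_mul]
    refine Real.exp_le_exp.mpr ?_
    calc T * Real.log K ≤ m * (κ * L) * Real.log K := by gcongr
      _ = m * L * (κ * Real.log K) := by ring
      _ ≤ _ := by gcongr
  have h5 : ∏ i, (q i : ℝ) ^ d i ≤ Real.exp (m * L * (1 + r / 8)) := by
    calc ∏ i, (q i : ℝ) ^ d i = Real.exp (∑ i, d i * Real.log (q i)) := by
          rw [Real.exp_sum]
          refine Finset.prod_congr rfl fun i _ => ?_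
          rw [Real.exp_nat_mul, Real.exp_log (hqR i)]
      _ ≤ _ := by
          refine Real.exp_le_exp.mpr ((Finset.sum_le_sum fun i _ => hup i).trans (le_of_eq ?_))
          simp only [Finset.sum_const, Finset.card_univ, Fintype.card_fin, nsmul_eq_mul]
          ring
  have h6 : (1 : ℝ) ≤ Real.exp (m * L * (r / 8)) * Real.exp (-((2 + r) * L * s)) *
      Real.exp (m * L * (1 + r / 8)) := by
    refine h2.trans ?_
    have h7 := h1.trans (mul_le_mul_of_nonneg_right (h3.trans h4) (Real.exp_pos _).le)
    have h8 : 0 ≤ ∏ i, (q i : ℝ) ^ d i := Finset.prod_nonneg fun i _ => (pow_pos (hqR i) _).le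
    gcongr
  rw [← Real.exp_add, ← Real.exp_add, Real.one_le_exp_iff] at h6
  have h7 := mul_le_mul_of_nonneg_right hs hL.le
  have hmR : (0 : ℝ) < m := by exact_mod_cast hm
  have h8 : 0 < m * L * r := by positivity
  nlinarith

/-- Roth's theorem for algebraic integers and reduced fractions of large denominator. -/
theorem exists_forall_rpow_lt_abs_sub {α : ℝ} (hα : IsIntegral ℤ α) {r : ℝ} (hr : 0 < r) :
    ∃ N : ℕ, ∀ (p : ℤ) (q : ℕ), N < q → IsCoprime p (q : ℤ) →
      (q : ℝ) ^ (-(2 + r)) < |α - p / q| := by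
  by_contra! hcon
  obtain ⟨D, A, hD, hA, haux⟩ := exists_length_le_indexGE hα
  set ε := r / (16 * (2 + r)) with hε
  have hε0 : 0 < ε := by positivity
  have hεr : (2 + r) * ε = r / 16 := by
    rw [hε]
    field_simp
  have hε2 : ε < 1 / 2 := by
    rw [hε, div_lt_div_iff₀ (by positivity) two_pos]
    linarith
  obtain ⟨m, hm⟩ := exists_nat_gt ((D : ℝ) / ε ^ 2)
  have hmR : (0 : ℝ) < m := lt_of_le_of_lt (by positivity) hm
  have hm0 : 0 < m := by exact_mod_cast hmR
  have hm1 : (1 : ℝ) ≤ m := by exact_mod_cast hm0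
  have hexp : 2 * D * Real.exp (-(2 * ε ^ 2 * m)) ≤ 1 := by
    rw [Real.exp_neg, ← div_eq_mul_inv, div_le_one (Real.exp_pos _)]
    rw [div_lt_iff₀ (by positivity)] at hm
    have := Real.add_one_le_exp (2 * ε ^ 2 * m)
    linarith
  obtain ⟨δ, hδ, hroth⟩ := exists_weight_le_eval_hasse_ne_zero m ε hε0
  have hA1 : (1 : ℝ) ≤ A := by exact_mod_cast hA
  have hα0 := abs_nonneg α
  set K := 8 * A * (1 + |α|) with hK
  have hAK : (A : ℝ) ≤ K := by nlinarith
  have hlogK : 0 < Real.log K := Real.log_pos (by nlinarith)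
  set κ := min δ (min (δ / (m * Real.log K)) (r / (8 * Real.log K)))
  have hκ : 0 < κ := by positivity
  have hκδ : κ ≤ δ := min_le_left _ _
  have hκ1 : κ * (m * Real.log K) ≤ δ := by
    rw [← le_div_iff₀ (by positivity)]
    exact (min_le_right _ _).trans (min_le_left _ _)
  have hκ2 : κ * Real.log K ≤ r / 8 := by
    rw [← le_div_iff₀ hlogK, div_div]
    exact (min_le_right _ _).trans (min_le_right _ _)
  obtain ⟨K₀, hK₀⟩ := exists_nat_ge (2 / δ)
  obtain ⟨N, hN⟩ := exists_nat_ge (Real.exp (2 / κ))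
  obtain ⟨p, q, hpq, hqq⟩ := exists_rapid_sequence
    (S := fun p q => IsCoprime p (q : ℤ) ∧ |α - p / q| ≤ (q : ℝ) ^ (-(2 + r))) hcon N K₀ m
  have hq : ∀ i, 0 < q i := fun i => (Nat.zero_le _).trans_lt (hpq i).1
  have hqR : ∀ i, (0 : ℝ) < q i := fun i => by exact_mod_cast hq i
  have hl : ∀ i, 2 / κ ≤ Real.log (q i) := by
    intro i
    rw [Real.le_log_iff_exp_le (hqR i)]
    exact hN.trans (by exact_mod_cast (hpq i).1.le)
  have hll : ∀ i j, i < j → 2 / δ * Real.log (q j) ≤ Real.log (q i) := by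
    intro i j hij
    have h1 : (q j : ℝ) ^ K₀ ≤ q i := by exact_mod_cast hqq i j hij
    have h2 := Real.log_le_log (pow_pos (hqR j) _) h1
    rw [Real.log_pow] at h2
    have h3 : 0 ≤ Real.log (q j) := le_trans (by positivity) (hl j)
    exact (mul_le_mul_of_nonneg_right hK₀ h3).trans h2
  obtain ⟨L, d, hL, hd0, hdd, hdL, hlow, hup⟩ :=
    exists_degrees hm0 hδ hκ (by positivity : 0 < r / 8) hl hll
  obtain ⟨P, hP0, hPd, hPlen, hPidx⟩ := haux m ε hm0 hε0 hε2 hexp d hd0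
  have hlogP : Real.log (length P) ≤ δ * L := by
    have h1 : (0 : ℝ) < length P := by exact_mod_cast one_le_length hP0
    have h2 := Real.log_le_log h1 hPlen
    rw [Real.log_pow] at h2
    have h3 : ((∑ i, d i : ℕ) : ℝ) ≤ m * (κ * L) := by
      rw [Nat.cast_sum]
      exact (Finset.sum_le_sum fun i _ => hdL i).trans (by simp)
    have h4 : Real.log A ≤ Real.log K := Real.log_le_log (by linarith) hAK
    calc Real.log (length P) ≤ ((∑ i, d i : ℕ) : ℝ) * Real.log A := h2
      _ ≤ ((∑ i, d i : ℕ) : ℝ) * Real.log K := by gcongr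
      _ ≤ m * (κ * L) * Real.log K := by gcongr
      _ = κ * (m * Real.log K) * L := by ring
      _ ≤ δ * L := by gcongr
  obtain ⟨μ, hμ, hμ0⟩ := hroth d p q L P
    { ne_zero := hP0
      degree_pos := hd0
      degree_le_mul := hdd
      denom_pos := hq
      coprime := fun i => (hpq i).2.1
      pos := hL
      degree_le := fun i => (hdL i).trans (by gcongr)
      le_log := hlow
      degreeOf_le := hPd
      log_length_le := hlogP }
  have hidx := (hPidx.hasse μ).mono (t := m * (1 / 2 - ε) - ε) (by linarith)
  rw [← map_hasse] at hidx hμ0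
  refine not_exists_small_value hm0 hr hL hA hq hdL hlow hup hκ2 (fun i => (hpq i).2.2)
    (fun i => (degreeOf_hasse_le μ P i).trans (hPd i)) ?_ ?_ hidx hμ0
  · have h1 : (length (hasse μ P) : ℝ) ≤ 2 ^ (∑ i, d i) * length P := by
      exact_mod_cast length_hasse_le μ P hPd
    refine h1.trans ?_
    rw [mul_pow]
    gcongr
  · have : (2 + r) * (m * (1 / 2 - ε) - ε) = m * (1 + r / 2) - (m + 1) * ((2 + r) * ε) := by ring
    rw [this, hεr]
    nlinarith

lemma exists_forall_le_abs_sub {α : ℝ} (hα : Irrational α) (N : ℕ) :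
    ∃ c > 0, ∀ (p : ℤ) (q : ℕ), 0 < q → q ≤ N → c ≤ |α - p / q| := by
  induction N with
  | zero => exact ⟨1, one_pos, fun p q h h' => by omega⟩
  | succ N ih =>
    obtain ⟨c, hc, h⟩ := ih
    have hN : (0 : ℝ) < (N + 1 : ℕ) := by positivity
    have hirr : Irrational (α * (N + 1 : ℕ)) := hα.mul_natCast (Nat.succ_ne_zero N)
    have hpos : 0 < |α * (N + 1 : ℕ) - round (α * (N + 1 : ℕ))| :=
      abs_pos.mpr (sub_ne_zero.mpr (hirr.ne_int _))
    refine ⟨min c (|α * (N + 1 : ℕ) - round (α * (N + 1 : ℕ))| / (N + 1 : ℕ)),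
      lt_min hc (div_pos hpos hN), fun p q hq hqN => ?_⟩
    rcases Nat.le_succ_iff.mp hqN with hq' | rfl
    · exact (min_le_left _ _).trans (h p q hq hq')
    · refine (min_le_right _ _).trans ?_
      rw [div_le_iff₀ hN]
      calc _ ≤ |α * (N + 1 : ℕ) - p| := round_le _ _
        _ = |α - p / (N + 1 : ℕ)| * (N + 1 : ℕ) := by
          nth_rewrite 3 [← abs_of_pos hN]
          rw [← abs_mul, sub_mul, div_mul_cancel₀ _ hN.ne']

/-- Roth's theorem for irrational algebraic integers. -/
theorem exists_forall_div_rpow_le_abs_sub {α : ℝ} (hα : IsIntegral ℤ α) (hirr : Irrational α)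
    {r : ℝ} (hr : 0 < r) :
    ∃ C > 0, ∀ x : ℚ, C / (x.den : ℝ) ^ (2 + r) ≤ |α - x| := by
  obtain ⟨N, hN⟩ := exists_forall_rpow_lt_abs_sub hα hr
  obtain ⟨c, hc, hcN⟩ := exists_forall_le_abs_sub hirr N
  refine ⟨min 1 c, lt_min one_pos hc, fun x => ?_⟩
  have hx : (x : ℝ) = x.num / x.den := Rat.cast_def x
  have hden : (1 : ℝ) ≤ x.den := by exact_mod_cast x.den_pos
  rw [hx]
  rcases lt_or_ge N x.den with h | h
  · refine le_trans ?_ (hN x.num x.den h x.isCoprime_num_den).le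
    rw [Real.rpow_neg (by positivity), ← one_div]
    gcongr
    exact min_le_left _ _
  · refine le_trans ?_ (hcN x.num x.den x.den_pos h)
    exact (div_le_self (lt_min one_pos hc).le (Real.one_le_rpow hden (by linarith))).trans
      (min_le_right _ _)

end RothTheorem

/-- **Roth's theorem** (form used in the paper, Proposition 2.1):
if `t` is an irrational algebraic real number and `r > 0`, then there exists
`C > 0` such that `|t - p/q| > C / |q|^(2+r)` for all integers `p` and all
nonzero integers `q`. -/
theorem roth_diophantine (t : ℝ) (ht : Irrational t) (halg : IsAlgebraic ℤ t)
    (r : ℝ) (hr : 0 < r) :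
    ∃ C : ℝ, 0 < C ∧ ∀ p q : ℤ, q ≠ 0 →
      C / |(q : ℝ)| ^ (2 + r) < |t - (p : ℝ) / (q : ℝ)| := by
  obtain ⟨a, ha, hint⟩ := halg.exists_integral_multiple
  have haR : (0 : ℝ) < |(a : ℝ)| := abs_pos.mpr (by exact_mod_cast ha)
  rw [zsmul_eq_mul] at hint
  obtain ⟨C, hC, h⟩ := RothTheorem.exists_forall_div_rpow_le_abs_sub hint (ht.intCast_mul ha) hr
  refine ⟨C / (2 * |(a : ℝ)|), by positivity, fun p q hq => ?_⟩
  have hq0 : (0 : ℝ) < |(q : ℝ)| := abs_pos.mpr (by exact_mod_cast hq)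
  have hden : (((a * p : ℤ) / (q : ℤ) : ℚ).den : ℝ) ≤ |(q : ℝ)| := by
    have h1 := Int.le_of_dvd (abs_pos.mpr hq) ((dvd_abs _ _).mpr (Rat.den_dvd (a * p) q))
    rw [Rat.divInt_eq_div] at h1
    exact_mod_cast h1
  have h2 := h ((a * p : ℤ) / (q : ℤ))
  have h3 : |a * t - (((a * p : ℤ) / (q : ℤ) : ℚ) : ℝ)| = |(a : ℝ)| * |t - p / q| := by
    rw [← abs_mul]
    congr 1
    push_cast
    ring
  rw [h3] at h2
  have hden0 : (0 : ℝ) < (((a * p : ℤ) / (q : ℤ) : ℚ).den : ℝ) := by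
    exact_mod_cast Rat.den_pos _
  have h4 : C / |(q : ℝ)| ^ (2 + r) ≤ |(a : ℝ)| * |t - p / q| := by
    refine le_trans ?_ h2
    gcongr
  have h5 : 0 < C / |(q : ℝ)| ^ (2 + r) := by positivity
  rw [div_div, mul_assoc, mul_comm |(a : ℝ)|, ← mul_assoc, ← div_div, div_lt_iff₀ haR,
    mul_comm 2, ← div_div]
  linarith
end

section
/- There exists a universal constant C > 0 (independent of ν, t, k, η, l) such that for all t ≥ 0, k ∈ ℤ, η ∈ ℝ, l ∈ ℤ, and ν ∈ (0,1], one has ν^{2/3} ≤ C · m(t,k,η,l). -/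
/-- The multiplier `m` of Section 4.3.1 of the paper (quadratic-growth
multiplier adapted to the Orr critical times), at inverse Reynolds number `ν`,
time `t` and frequency `(k, η, l)`. -/
noncomputable def mMul (ν t : ℝ) (k : ℤ) (η : ℝ) (l : ℤ) : ℝ :=
  if k = 0 then 1
  else if η * (k : ℝ) < 0 then
    (if 4 * ν ^ (-(1 : ℝ) / 3) * |(k : ℝ)| ≤ |η| then 1
     else if t < η / (k : ℝ) + 4 * ν ^ (-(1 : ℝ) / 3) then
       ((k : ℝ) ^ 2 + η ^ 2 + (l : ℝ) ^ 2) /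
         ((k : ℝ) ^ 2 + (η - (k : ℝ) * t) ^ 2 + (l : ℝ) ^ 2)
     else
       ((k : ℝ) ^ 2 + η ^ 2 + (l : ℝ) ^ 2) /
         ((k : ℝ) ^ 2 + 16 * (k : ℝ) ^ 2 * ν ^ (-(2 : ℝ) / 3) + (l : ℝ) ^ 2))
  else
    (if t ≤ η / (k : ℝ) then 1
     else if t < η / (k : ℝ) + 4 * ν ^ (-(1 : ℝ) / 3) then
       ((k : ℝ) ^ 2 + (l : ℝ) ^ 2) /
         ((k : ℝ) ^ 2 + (η - (k : ℝ) * t) ^ 2 + (l : ℝ) ^ 2)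
     else
       ((k : ℝ) ^ 2 + (l : ℝ) ^ 2) /
         ((k : ℝ) ^ 2 + 16 * (k : ℝ) ^ 2 * ν ^ (-(2 : ℝ) / 3) + (l : ℝ) ^ 2))

/-- The modified multiplier `m̃` of Section 4.3.1 of the paper, which weakens
indefinitely after the critical time, at time `t` and frequency `(k, η, l)`. -/
noncomputable def mTil (ν t : ℝ) (k : ℤ) (η : ℝ) (l : ℤ) : ℝ :=
  if k = 0 then 1
  else if η * (k : ℝ) < 0 then
    ((k : ℝ) ^ 2 + η ^ 2 + (l : ℝ) ^ 2) /
      ((k : ℝ) ^ 2 + (η - (k : ℝ) * t) ^ 2 + (l : ℝ) ^ 2)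
  else if t ≤ η / (k : ℝ) then 1
  else
    ((k : ℝ) ^ 2 + (l : ℝ) ^ 2) /
      ((k : ℝ) ^ 2 + (η - (k : ℝ) * t) ^ 2 + (l : ℝ) ^ 2)

/-- A quotient of quadratic symbols is bounded below by `s / 17` as soon as its denominator is
controlled by the truncated one, where `s * a ^ 2 = 1`. -/
theorem le_mul_div_of_le_truncated {s a x y N D : ℝ} (hs : 0 < s) (hs1 : s ≤ 1)
    (hsa : s * a ^ 2 = 1) (hN : x ^ 2 + y ^ 2 ≤ N) (hD : 0 < D)
    (hDle : D ≤ x ^ 2 + 16 * x ^ 2 * a ^ 2 + y ^ 2) : s ≤ 17 * (N / D) := by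
  rw [← mul_div_assoc, le_div_iff₀ hD]
  calc s * D ≤ s * (x ^ 2 + 16 * x ^ 2 * a ^ 2 + y ^ 2) := by gcongr
    _ = s * (x ^ 2 + y ^ 2) + 16 * x ^ 2 * (s * a ^ 2) := by ring
    _ ≤ 1 * (x ^ 2 + y ^ 2) + 16 * x ^ 2 * 1 := by rw [hsa]; gcongr
    _ ≤ 17 * N := by nlinarith [sq_nonneg y]

/-- Within a time window of length `4 * a` after the critical time `η / x`, the shifted frequency
is at most `4 * |x| * a`. -/
theorem sub_mul_sq_le_of_mem_window {x η t a : ℝ} (hx : x ≠ 0) (h₁ : η / x ≤ t)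
    (h₂ : t < η / x + 4 * a) : (η - x * t) ^ 2 ≤ 16 * x ^ 2 * a ^ 2 := by
  have h : η - x * t = -x * (t - η / x) := by field_simp; ring
  have hsq : (t - η / x) ^ 2 ≤ (4 * a) ^ 2 :=
    pow_le_pow_left₀ (by linarith) (by linarith) 2
  calc (η - x * t) ^ 2 = x ^ 2 * (t - η / x) ^ 2 := by rw [h]; ring
    _ ≤ x ^ 2 * (4 * a) ^ 2 := by gcongr
    _ = 16 * x ^ 2 * a ^ 2 := by ring

/-- Lemma 4.1 (4.8c) of the paper: `ν^{2/3} ≲ m` with a universal implicit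
constant. -/
theorem nu_pow_le_mMul :
    ∃ C : ℝ, 0 < C ∧ ∀ ν t : ℝ, 0 < ν → ν ≤ 1 → 0 ≤ t →
      ∀ (k : ℤ) (η : ℝ) (l : ℤ),
        ν ^ ((2 : ℝ) / 3) ≤ C * mMul ν t k η l := by
  refine ⟨17, by norm_num, fun ν t hν hν1 ht k η l => ?_⟩
  have hs : 0 < ν ^ ((2 : ℝ) / 3) := Real.rpow_pos_of_pos hν _
  have hs1 : ν ^ ((2 : ℝ) / 3) ≤ 1 := Real.rpow_le_one hν.le hν1 (by norm_num)
  have ha2 : ν ^ (-(2 : ℝ) / 3) = (ν ^ (-(1 : ℝ) / 3)) ^ 2 := by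
    rw [← Real.rpow_mul_natCast hν.le]; norm_num
  have hsa : ν ^ ((2 : ℝ) / 3) * (ν ^ (-(1 : ℝ) / 3)) ^ 2 = 1 := by
    rw [← ha2, ← Real.rpow_add hν]; norm_num
  unfold mMul
  rw [ha2]
  by_cases hk : k = 0
  · rw [if_pos hk]; linarith
  have hx : (k : ℝ) ≠ 0 := Int.cast_ne_zero.mpr hk
  rw [if_neg hk]
  split_ifs with hηk _ hlt hle hlt
  · linarith
  · have hcrit : η / (k : ℝ) ≤ t :=
      calc η / (k : ℝ) = η * k / (k : ℝ) ^ 2 := by field_simp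
        _ ≤ 0 := div_nonpos_of_nonpos_of_nonneg hηk.le (sq_nonneg _)
        _ ≤ t := ht
    refine le_mul_div_of_le_truncated (x := k) (y := l) hs hs1 hsa ?_ (by positivity) ?_
    · linarith [sq_nonneg η]
    · linarith [sub_mul_sq_le_of_mem_window hx hcrit hlt]
  · refine le_mul_div_of_le_truncated hs hs1 hsa ?_ (by positivity) le_rfl
    linarith [sq_nonneg η]
  · linarith
  · refine le_mul_div_of_le_truncated hs hs1 hsa le_rfl (by positivity) ?_
    linarith [sub_mul_sq_le_of_mem_window hx (not_le.mp hle).le hlt]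
  · exact le_mul_div_of_le_truncated hs hs1 hsa le_rfl (by positivity) le_rfl
end

section
/- There exists a universal constant C > 0 (independent of ν, t, k, η, l) such that for all t ≥ 0, k ∈ ℤ, η ∈ ℝ, l ∈ ℤ, and ν ∈ (0,1], one has 1/m̃(t,k,η,l) + 1/m(t,k,η,l) ≤ C (1 + t²). -/
theorem one_div_div_le_of_le_mul {a b c : ℝ} (ha : 0 < a) (h : b ≤ c * a) :
    1 / (a / b) ≤ c := by
  rw [one_div_div, div_le_iff₀ ha]
  exact h

theorem rpow_neg_two_thirds {ν : ℝ} (hν : 0 < ν) :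
    ν ^ (-(2 : ℝ) / 3) = (ν ^ (-(1 : ℝ) / 3)) ^ 2 := by
  rw [← Real.rpow_natCast, ← Real.rpow_mul hν.le]
  norm_num

theorem one_div_mTil_le {ν t : ℝ} (ht : 0 ≤ t) (k : ℤ) (η : ℝ) (l : ℤ) :
    1 / mTil ν t k η l ≤ 2 * (1 + t ^ 2) := by
  unfold mTil
  split_ifs with hk hneg hcrit
  · nlinarith [sq_nonneg t]
  · have hk2 : 0 < (k : ℝ) ^ 2 := by positivity
    apply one_div_div_le_of_le_mul (by positivity)
    nlinarith [sq_nonneg (η + k * t), mul_nonneg (sq_nonneg t) (sq_nonneg η),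
      mul_nonneg (sq_nonneg t) (sq_nonneg (l : ℝ)), sq_nonneg (l : ℝ)]
  · nlinarith [sq_nonneg t]
  · have hk0 : (k : ℝ) ≠ 0 := by exact_mod_cast hk
    have hk2 : 0 < (k : ℝ) ^ 2 := by positivity
    apply one_div_div_le_of_le_mul (by positivity)
    have hdom : (η - k * t) ^ 2 ≤ (k : ℝ) ^ 2 * t ^ 2 := by
      obtain ⟨s, rfl⟩ : ∃ s, η = k * s := ⟨η / k, by field_simp⟩
      rw [mul_div_cancel_left₀ s hk0] at hcrit
      have hs : 0 ≤ s := by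
        by_contra! hs
        exact hneg (by nlinarith)
      rw [← mul_sub, mul_pow]
      gcongr ?_ * ?_
      nlinarith
    nlinarith [mul_nonneg (sq_nonneg t) (sq_nonneg (l : ℝ)), sq_nonneg (l : ℝ),
      mul_nonneg (sq_nonneg t) hk2.le]

theorem mMul_eq_mTil_of_lt {ν t : ℝ} {k : ℤ} {η : ℝ} {l : ℤ} (hk : k ≠ 0)
    (h : η * (k : ℝ) < 0 → |η| < 4 * ν ^ (-(1 : ℝ) / 3) * |(k : ℝ)|)
    (ht : t < η / (k : ℝ) + 4 * ν ^ (-(1 : ℝ) / 3)) :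
    mMul ν t k η l = mTil ν t k η l := by
  unfold mMul mTil
  by_cases hneg : η * (k : ℝ) < 0
  · simp only [if_neg hk, if_pos hneg, if_neg (h hneg).not_ge, if_pos ht]
  · simp only [if_neg hk, if_neg hneg, if_pos ht]

theorem one_div_mMul_le {ν t : ℝ} (hν : 0 < ν) (ht : 0 ≤ t) (k : ℤ) (η : ℝ) (l : ℤ) :
    1 / mMul ν t k η l ≤ 2 * (1 + t ^ 2) := by
  by_cases hk : k = 0
  · simp only [mMul, if_pos hk]
    nlinarith [sq_nonneg t]
  by_cases hfar : η * (k : ℝ) < 0 ∧ 4 * ν ^ (-(1 : ℝ) / 3) * |(k : ℝ)| ≤ |η|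
  · simp only [mMul, if_neg hk, if_pos hfar.1, if_pos hfar.2]
    nlinarith [sq_nonneg t]
  have hnear : η * (k : ℝ) < 0 → |η| < 4 * ν ^ (-(1 : ℝ) / 3) * |(k : ℝ)| :=
    fun h => not_le.mp fun h' => hfar ⟨h, h'⟩
  by_cases hlt : t < η / (k : ℝ) + 4 * ν ^ (-(1 : ℝ) / 3)
  · rw [mMul_eq_mTil_of_lt hk hnear hlt]
    exact one_div_mTil_le ht k η l
  have hk0 : (k : ℝ) ≠ 0 := by exact_mod_cast hk
  have hk2 : 0 < (k : ℝ) ^ 2 := by positivity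
  have hr : 0 < ν ^ (-(1 : ℝ) / 3) := Real.rpow_pos_of_pos hν _
  unfold mMul
  rw [rpow_neg_two_thirds hν]
  simp only [if_neg hk, if_neg hlt]
  generalize ν ^ (-(1 : ℝ) / 3) = r at *
  obtain ⟨s, rfl⟩ : ∃ s, η = k * s := ⟨η / k, by field_simp⟩
  rw [mul_div_cancel_left₀ s hk0, not_lt] at hlt
  rw [mul_div_cancel_left₀ s hk0]
  split_ifs with hneg hge hcrit
  · nlinarith [sq_nonneg t]
  · apply one_div_div_le_of_le_mul (by positivity)
    have hdom : (4 * r) ^ 2 ≤ 2 * t ^ 2 + 2 * s ^ 2 := by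
      have hs : s < 0 := by
        by_contra! hs
        nlinarith
      nlinarith [sq_nonneg (t + s)]
    nlinarith [mul_le_mul_of_nonneg_left hdom hk2.le, sq_nonneg (l : ℝ),
      mul_nonneg (sq_nonneg t) (sq_nonneg (l : ℝ)),
      mul_nonneg (sq_nonneg t) (sq_nonneg ((k : ℝ) * s))]
  · nlinarith [sq_nonneg t]
  · apply one_div_div_le_of_le_mul (by positivity)
    have hdom : (4 * r) ^ 2 ≤ t ^ 2 := by
      have hs : 0 ≤ s := by
        by_contra! hs
        exact hneg (by nlinarith)
      gcongr
      linarith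
    nlinarith [mul_le_mul_of_nonneg_left hdom hk2.le, sq_nonneg (l : ℝ),
      mul_nonneg (sq_nonneg t) (sq_nonneg (l : ℝ)), mul_nonneg (sq_nonneg t) hk2.le]

/-- Lemma 4.1 (4.8d) of the paper: `1/m̃ + 1/m ≲ ⟨t⟩²` with a universal
implicit constant. -/
theorem inv_mTil_add_inv_mMul_le :
    ∃ C : ℝ, 0 < C ∧ ∀ ν t : ℝ, 0 < ν → ν ≤ 1 → 0 ≤ t →
      ∀ (k : ℤ) (η : ℝ) (l : ℤ),
        1 / mTil ν t k η l + 1 / mMul ν t k η l ≤ C * (1 + t ^ 2) := by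
  refine ⟨4, by norm_num, fun ν t hν _ ht k η l => ?_⟩
  linarith [one_div_mTil_le (ν := ν) ht k η l, one_div_mMul_le hν ht k η l]
end

section
/- There exists a universal constant C > 0 (independent of ν, t and all frequencies) such that for all t ≥ 0, k ∈ ℤ, η, η′ ∈ ℝ, l, l′ ∈ ℤ, and ν ∈ (0,1], one has m̃(t,k,η,l)/m̃(t,k,η′,l′) + m(t,k,η,l)/m(t,k,η′,l′) ≤ C (⟨η − η′⟩² + ⟨l − l′⟩²), where ⟨a⟩ = √(1 + a²). -/
/-- The ratio `m / m'` of two quotients `U / V` and `U' / V'` grows only linearly in the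
displacement `D`, because the numerators are dominated by the denominators. -/
theorem div_div_div_le_of_le_two_mul_add {U V U' V' D : ℝ} (hU : 0 ≤ U) (hUV : U ≤ V)
    (hV : 0 < V) (hU' : 1 ≤ U') (hD : 0 ≤ D) (h₁ : U ≤ 2 * U' + 2 * D)
    (h₂ : V' ≤ 2 * V + 2 * D) : U / V / (U' / V') ≤ 4 + 6 * D := by
  rw [div_div_div_eq, div_le_iff₀ (by positivity)]
  have e₁ : U * V' ≤ U * (2 * V + 2 * D) := mul_le_mul_of_nonneg_left h₂ hU
  have e₂ : U * V ≤ (2 * U' + 2 * D) * V := mul_le_mul_of_nonneg_right h₁ hV.le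
  have e₃ : U * D ≤ V * D := mul_le_mul_of_nonneg_right hUV hD
  have e₄ : V * D * 1 ≤ V * D * U' := mul_le_mul_of_nonneg_left hU' (by positivity)
  nlinarith

theorem sum_sq_le_two_mul_add {a P P' x l l' : ℝ} (h : |P - P'| ≤ |x|) :
    a ^ 2 + P ^ 2 + l ^ 2 ≤
      2 * (a ^ 2 + P' ^ 2 + l' ^ 2) + 2 * (x ^ 2 + (l - l') ^ 2) := by
  have h' := sq_le_sq.2 h
  nlinarith [sq_nonneg (P - 2 * P'), sq_nonneg (l - 2 * l'), sq_nonneg a]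

theorem abs_min_max_sub_min_max_le (x y N : ℝ) :
    |min (max x 0) N - min (max y 0) N| ≤ |x - y| :=
  (by simpa using abs_min_sub_min_le_max (max x 0) N (max y 0) N :
    |min (max x 0) N - min (max y 0) N| ≤ |max x 0 - max y 0|).trans
    (abs_max_sub_max_le_abs x y 0)

theorem div_div_div_sum_sq_le {a P Q P' Q' x l l' : ℝ} (ha : 1 ≤ a) (hP : 0 ≤ P)
    (hPQ : P ≤ Q) (h₁ : |P - P'| ≤ |x|) (h₂ : |Q' - Q| ≤ |x|) :
    (a ^ 2 + P ^ 2 + l ^ 2) / (a ^ 2 + Q ^ 2 + l ^ 2) /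
      ((a ^ 2 + P' ^ 2 + l' ^ 2) / (a ^ 2 + Q' ^ 2 + l' ^ 2)) ≤
      4 + 6 * (x ^ 2 + (l - l') ^ 2) := by
  refine div_div_div_le_of_le_two_mul_add (by positivity) (by gcongr) (by positivity)
    (by nlinarith [sq_nonneg P', sq_nonneg l']) (by positivity)
    (sum_sq_le_two_mul_add h₁) ?_
  rw [← neg_sub l' l, neg_sq]
  exact sum_sq_le_two_mul_add h₂

theorem mTil_neg_neg (ν t : ℝ) (k : ℤ) (η : ℝ) (l : ℤ) :
    mTil ν t (-k) (-η) l = mTil ν t k η l := by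
  have h : (-η + k * t) ^ 2 = (η - k * t) ^ 2 := by ring
  simp [mTil, neg_div_neg_eq, h]

theorem mMul_neg_neg (ν t : ℝ) (k : ℤ) (η : ℝ) (l : ℤ) :
    mMul ν t (-k) (-η) l = mMul ν t k η l := by
  have h : (-η + k * t) ^ 2 = (η - k * t) ^ 2 := by ring
  simp [mMul, neg_div_neg_eq, h]

theorem mTil_eq_of_pos (ν : ℝ) {t : ℝ} (ht : 0 ≤ t) {k : ℤ} (hk : 0 < k) (η : ℝ) (l : ℤ) :
    mTil ν t k η l =
      ((k : ℝ) ^ 2 + max (-η) 0 ^ 2 + (l : ℝ) ^ 2) /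
        ((k : ℝ) ^ 2 + max (k * t - η) 0 ^ 2 + (l : ℝ) ^ 2) := by
  have ha : (0 : ℝ) < k := by exact_mod_cast hk
  unfold mTil
  rw [if_neg hk.ne', ← neg_sub (k * t) η, neg_sq]
  generalize (k : ℝ) = a at ha ⊢
  have hat : 0 ≤ a * t := by positivity
  simp only [le_div_iff₀ ha]
  split_ifs with c₁ c₂
  · have hη : η < 0 := by nlinarith
    rw [max_eq_left (by linarith), max_eq_left (by linarith), neg_sq]
  · have hη : 0 ≤ η := by nlinarith
    rw [max_eq_right (by linarith), max_eq_right (by linarith), div_self (by positivity)]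
  · have hη : 0 ≤ η := by nlinarith
    rw [max_eq_right (by linarith), max_eq_left (by linarith)]
    ring

theorem mMul_eq_of_pos {ν t : ℝ} (hν : 0 < ν) (ht : 0 ≤ t) {k : ℤ} (hk : 0 < k)
    (η : ℝ) (l : ℤ) :
    mMul ν t k η l =
      ((k : ℝ) ^ 2 + min (max (-η) 0) (4 * ν ^ (-(1 : ℝ) / 3) * k) ^ 2 + (l : ℝ) ^ 2) /
        ((k : ℝ) ^ 2 + min (max (k * t - η) 0) (4 * ν ^ (-(1 : ℝ) / 3) * k) ^ 2 +
          (l : ℝ) ^ 2) := by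
  have ha : (0 : ℝ) < k := by exact_mod_cast hk
  have hν2 : ν ^ (-(2 : ℝ) / 3) = (ν ^ (-(1 : ℝ) / 3)) ^ 2 := by
    rw [← Real.rpow_natCast, ← Real.rpow_mul hν.le]
    norm_num
  have hM : 0 < ν ^ (-(1 : ℝ) / 3) := Real.rpow_pos_of_pos hν _
  unfold mMul
  rw [if_neg hk.ne', ← neg_sub (k * t) η, neg_sq, abs_of_pos ha, hν2]
  generalize ν ^ (-(1 : ℝ) / 3) = M at hM ⊢
  generalize (k : ℝ) = a at ha ⊢
  have hat : 0 ≤ a * t := by positivity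
  have hMa : 0 < 4 * M * a := by positivity
  have hlt : t < η / a + 4 * M ↔ a * t - η < 4 * M * a := by
    rw [div_add' _ _ _ ha.ne', lt_div_iff₀ ha]
    constructor <;> intro h <;> linarith
  simp only [hlt, le_div_iff₀ ha]
  split_ifs with c₁ c₂ c₃ c₄ c₅
  · have hη : η < 0 := by nlinarith
    rw [abs_of_neg hη] at c₂
    rw [max_eq_left (by linarith), max_eq_left (by linarith), min_eq_right (by linarith),
      min_eq_right (by linarith), div_self (by positivity)]
  · have hη : η < 0 := by nlinarith
    rw [abs_of_neg hη] at c₂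
    rw [max_eq_left (by linarith), max_eq_left (by linarith), min_eq_left (by linarith),
      min_eq_left (by linarith), neg_sq]
  · have hη : η < 0 := by nlinarith
    rw [abs_of_neg hη] at c₂
    rw [max_eq_left (by linarith), max_eq_left (by linarith), min_eq_left (by linarith),
      min_eq_right (by linarith), neg_sq]
    ring
  · have hη : 0 ≤ η := by nlinarith
    rw [max_eq_right (by linarith), max_eq_right (by linarith), div_self (by positivity)]
  · have hη : 0 ≤ η := by nlinarith
    rw [max_eq_right (by linarith), max_eq_left (by linarith), min_eq_left (by linarith),
      min_eq_left (by linarith)]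
    ring
  · have hη : 0 ≤ η := by nlinarith
    rw [max_eq_right (by linarith), max_eq_left (by linarith), min_eq_left (by linarith),
      min_eq_right (by linarith)]
    ring

theorem mTil_div_add_mMul_div_le_of_pos {ν t : ℝ} (hν : 0 < ν) (ht : 0 ≤ t) {k : ℤ}
    (hk : 0 < k) (η η' : ℝ) (l l' : ℤ) :
    mTil ν t k η l / mTil ν t k η' l' + mMul ν t k η l / mMul ν t k η' l' ≤
      8 + 12 * ((η - η') ^ 2 + ((l : ℝ) - l') ^ 2) := by
  have ha : (1 : ℝ) ≤ k := by exact_mod_cast hk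
  have hat : 0 ≤ k * t := by positivity
  have hM : 0 ≤ 4 * ν ^ (-(1 : ℝ) / 3) * k := by positivity
  have d₁ : |-η - -η'| = |η - η'| := by rw [neg_sub_neg, abs_sub_comm]
  have d₂ : |(k * t - η') - (k * t - η)| = |η - η'| := by rw [sub_sub_sub_cancel_left]
  have hle : max (-η) 0 ≤ max (k * t - η) 0 := max_le_max_right 0 (by linarith)
  have b₁ := div_div_div_sum_sq_le (l := l) (l' := l') ha (le_max_right _ _) hle
    ((abs_max_sub_max_le_abs _ _ 0).trans_eq d₁) ((abs_max_sub_max_le_abs _ _ 0).trans_eq d₂)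
  have b₂ := div_div_div_sum_sq_le (l := l) (l' := l') ha
    (le_min (le_max_right _ _) hM) (min_le_min_right _ hle)
    ((abs_min_max_sub_min_max_le _ _ _).trans_eq d₁)
    ((abs_min_max_sub_min_max_le _ _ _).trans_eq d₂)
  rw [← mTil_eq_of_pos ν ht hk, ← mTil_eq_of_pos ν ht hk] at b₁
  rw [← mMul_eq_of_pos hν ht hk, ← mMul_eq_of_pos hν ht hk] at b₂
  linarith

/-- Lemma 4.1 (4.8e) of the paper: the commutation estimate
`m̃(t,k,η,l)/m̃(t,k,η',l') + m(t,k,η,l)/m(t,k,η',l') ≲ ⟨η - η'⟩² + ⟨l - l'⟩²`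
with a universal implicit constant, where `⟨a⟩ = √(1 + a²)`. -/
theorem mTil_mMul_commutation :
    ∃ C : ℝ, 0 < C ∧ ∀ ν t : ℝ, 0 < ν → ν ≤ 1 → 0 ≤ t →
      ∀ (k : ℤ) (η η' : ℝ) (l l' : ℤ),
        mTil ν t k η l / mTil ν t k η' l' + mMul ν t k η l / mMul ν t k η' l' ≤
          C * (Real.sqrt (1 + (η - η') ^ 2) ^ 2 +
               Real.sqrt (1 + ((l : ℝ) - (l' : ℝ)) ^ 2) ^ 2) := by
  refine ⟨12, by norm_num, fun ν t hν _ ht k η η' l l' => ?_⟩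
  rw [Real.sq_sqrt (by positivity), Real.sq_sqrt (by positivity)]
  rcases lt_trichotomy k 0 with hk | rfl | hk
  · have h := mTil_div_add_mMul_div_le_of_pos hν ht (neg_pos.2 hk) (-η) (-η') l l'
    rw [mTil_neg_neg, mTil_neg_neg, mMul_neg_neg, mMul_neg_neg, neg_sub_neg, sub_sq_comm] at h
    linarith
  · simp only [mTil, mMul, if_true]
    nlinarith [sq_nonneg (η - η'), sq_nonneg ((l : ℝ) - l')]
  · have h := mTil_div_add_mMul_div_le_of_pos hν ht hk η η' l l'
    linarith
end

section
/- There exists a universal constant c₂ > 0 such that for all ν ∈ (0,1], all t ≥ 0, all k ∈ ℤ, η ∈ ℝ, l ∈ ℤ, and each j ∈ {1,2,3}, one has c₂ ≤ M_j(t,k,η,l) ≤ 1. -/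
/-- The ghost multiplier `M₁` of Section 4.3.2 of the paper, defined (for
`k ≠ 0`) by `M₁(0) = 1` and `-Ṁ₁/M₁ = k²/(k² + l² + (η - k t)²)`; for `k = 0`
it is identically `1`. -/
noncomputable def M1 (t : ℝ) (k : ℤ) (η : ℝ) (l : ℤ) : ℝ :=
  if k = 0 then 1
  else Real.exp (-(∫ s in (0 : ℝ)..t,
    (k : ℝ) ^ 2 / ((k : ℝ) ^ 2 + (l : ℝ) ^ 2 + (η - (k : ℝ) * s) ^ 2)))

/-- The ghost multiplier `M₂` of Section 4.3.2 of the paper, defined (for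
`k ≠ 0`) by `M₂(0) = 1` and `-Ṁ₂/M₂ = ⟨k l⟩/(k² + l² + (η - k t)²)`; for
`k = 0` it is identically `1`. -/
noncomputable def M2 (t : ℝ) (k : ℤ) (η : ℝ) (l : ℤ) : ℝ :=
  if k = 0 then 1
  else Real.exp (-(∫ s in (0 : ℝ)..t,
    Real.sqrt (1 + ((k : ℝ) * (l : ℝ)) ^ 2) /
      ((k : ℝ) ^ 2 + (l : ℝ) ^ 2 + (η - (k : ℝ) * s) ^ 2)))

/-- The ghost multiplier `M₃` of Section 4.3.2 of the paper, defined (for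
`k ≠ 0`) by `M₃(0) = 1` and `-Ṁ₃/M₃ = ν^{1/3} k²/(k² + l² + ν^{2/3}(η - k t)²)`;
for `k = 0` it is identically `1`. -/
noncomputable def M3 (ν t : ℝ) (k : ℤ) (η : ℝ) (l : ℤ) : ℝ :=
  if k = 0 then 1
  else Real.exp (-(∫ s in (0 : ℝ)..t,
    ν ^ ((1 : ℝ) / 3) * (k : ℝ) ^ 2 /
      ((k : ℝ) ^ 2 + (l : ℝ) ^ 2 + ν ^ ((2 : ℝ) / 3) * (η - (k : ℝ) * s) ^ 2)))

theorem integral_div_sq_add_sq_mul_sub {b k : ℝ} (hb : b ≠ 0) (hk : k ≠ 0) {D : ℝ} (hD : 0 < D)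
    (A η t : ℝ) :
    ∫ s in (0 : ℝ)..t, A / (D ^ 2 + b ^ 2 * (η - k * s) ^ 2) =
      A / (b * k * D) * (Real.arctan (b * η / D) - Real.arctan (b * (η - k * t) / D)) := by
  have hpos : ∀ s : ℝ, 0 < D ^ 2 + b ^ 2 * (η - k * s) ^ 2 := fun s => by positivity
  have hderiv : ∀ s : ℝ, HasDerivAt
      (fun s => -(A / (b * k * D)) * Real.arctan (b * (η - k * s) / D))
      (A / (D ^ 2 + b ^ 2 * (η - k * s) ^ 2)) s := fun s => by
    have hlin : HasDerivAt (fun s : ℝ => b * (η - k * s) / D) (b * (-(k * 1)) / D) s :=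
      ((((hasDerivAt_id s).const_mul k).const_sub η).const_mul b).div_const D
    refine (hlin.arctan.const_mul (-(A / (b * k * D)))).congr_deriv ?_
    have h₁ := (hpos s).ne'
    have h₂ : 1 + (b * (η - k * s) / D) ^ 2 = (D ^ 2 + b ^ 2 * (η - k * s) ^ 2) / D ^ 2 := by
      field_simp
    rw [h₂]
    field_simp
  rw [intervalIntegral.integral_eq_sub_of_hasDerivAt (fun s _ => hderiv s)
    (Continuous.intervalIntegrable
      (continuous_const.div (by fun_prop) fun s => (hpos s).ne') 0 t)]
  simp only [mul_zero, sub_zero]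
  ring

theorem integral_div_sq_add_sq_mul_sub_le_pi {A b k D : ℝ} (hA : 0 ≤ A) (hb : 0 < b) (hk : k ≠ 0)
    (hD : 0 < D) (hAD : A ≤ b * |k| * D) (η t : ℝ) :
    ∫ s in (0 : ℝ)..t, A / (D ^ 2 + b ^ 2 * (η - k * s) ^ 2) ≤ Real.pi := by
  rw [integral_div_sq_add_sq_mul_sub hb.ne' hk hD]
  refine (le_abs_self _).trans ?_
  have hk' : 0 < |k| := abs_pos.mpr hk
  have hcoef : |A / (b * k * D)| ≤ 1 := by
    rw [abs_div, abs_mul, abs_mul, abs_of_nonneg hA, abs_of_pos hb, abs_of_pos hD]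
    exact (div_le_one (by positivity)).mpr hAD
  have harctan : |Real.arctan (b * η / D) - Real.arctan (b * (η - k * t) / D)| ≤ Real.pi := by
    have h₁ := Real.arctan_lt_pi_div_two (b * η / D)
    have h₂ := Real.neg_pi_div_two_lt_arctan (b * η / D)
    have h₃ := Real.arctan_lt_pi_div_two (b * (η - k * t) / D)
    have h₄ := Real.neg_pi_div_two_lt_arctan (b * (η - k * t) / D)
    exact abs_le.mpr ⟨by linarith, by linarith⟩
  rw [abs_mul]
  simpa using mul_le_mul hcoef harctan (abs_nonneg _) zero_le_one

theorem exp_neg_integral_mem_Icc {A b k D : ℝ} (hA : 0 ≤ A) (hb : 0 < b) (hk : k ≠ 0)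
    (hD : 0 < D) (hAD : A ≤ b * |k| * D) (η : ℝ) {t : ℝ} (ht : 0 ≤ t) :
    Real.exp (-∫ s in (0 : ℝ)..t, A / (D ^ 2 + b ^ 2 * (η - k * s) ^ 2)) ∈
      Set.Icc (Real.exp (-Real.pi)) 1 := by
  refine ⟨Real.exp_le_exp.mpr
      (neg_le_neg (integral_div_sq_add_sq_mul_sub_le_pi hA hb hk hD hAD η t)),
    Real.exp_le_one_iff.mpr (neg_nonpos.mpr ?_)⟩
  exact intervalIntegral.integral_nonneg ht fun s _ => by positivity

/-- Inequality (4.11) of the paper: there is a universal constant `c₂ > 0` with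
`c₂ ≤ M_j ≤ 1` for each `j ∈ {1,2,3}`, uniformly in `ν ∈ (0,1]`, `t ≥ 0` and
the frequency `(k, η, l)`. -/
theorem ghost_multipliers_bounded :
    ∃ c₂ : ℝ, 0 < c₂ ∧ ∀ ν t : ℝ, 0 < ν → ν ≤ 1 → 0 ≤ t →
      ∀ (k : ℤ) (η : ℝ) (l : ℤ),
        (c₂ ≤ M1 t k η l ∧ M1 t k η l ≤ 1) ∧
        (c₂ ≤ M2 t k η l ∧ M2 t k η l ≤ 1) ∧
        (c₂ ≤ M3 ν t k η l ∧ M3 ν t k η l ≤ 1) := by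
  refine ⟨Real.exp (-Real.pi), Real.exp_pos _, fun ν t hν _ ht k η l => ?_⟩
  rcases eq_or_ne k 0 with rfl | hk
  · have hπ : Real.exp (-Real.pi) ≤ 1 := Real.exp_le_one_iff.mpr (by linarith [Real.pi_pos])
    simp [M1, M2, M3, hπ]
  have hkℝ : (k : ℝ) ≠ 0 := Int.cast_ne_zero.mpr hk
  have hk_one : (1 : ℝ) ≤ |(k : ℝ)| := by exact_mod_cast Int.one_le_abs hk
  have hsum : (0 : ℝ) < (k : ℝ) ^ 2 + (l : ℝ) ^ 2 := by positivity
  set D : ℝ := Real.sqrt ((k : ℝ) ^ 2 + (l : ℝ) ^ 2)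
  have hD : 0 < D := Real.sqrt_pos.mpr hsum
  have hDsq : D ^ 2 = (k : ℝ) ^ 2 + (l : ℝ) ^ 2 := Real.sq_sqrt hsum.le
  have hkD : |(k : ℝ)| ≤ D := Real.abs_le_sqrt (by nlinarith [sq_nonneg (l : ℝ)])
  have hksq : (k : ℝ) ^ 2 ≤ |(k : ℝ)| * D := by
    rw [← sq_abs, sq]
    gcongr
  have hsqrt : Real.sqrt (1 + ((k : ℝ) * (l : ℝ)) ^ 2) ≤ |(k : ℝ)| * D := by
    refine Real.sqrt_le_iff.mpr ⟨by positivity, ?_⟩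
    have hone : (1 : ℝ) ≤ (k : ℝ) ^ 2 := by
      rw [← sq_abs]
      exact one_le_pow₀ hk_one
    rw [mul_pow, mul_pow, sq_abs, hDsq]
    nlinarith
  have hb : 0 < ν ^ ((1 : ℝ) / 3) := Real.rpow_pos_of_pos hν _
  have hbsq : ν ^ ((2 : ℝ) / 3) = (ν ^ ((1 : ℝ) / 3)) ^ 2 := by
    rw [← Real.rpow_natCast, ← Real.rpow_mul hν.le]
    norm_num
  have h₁ := exp_neg_integral_mem_Icc (sq_nonneg (k : ℝ)) one_pos hkℝ hD
    (by simpa using hksq) η ht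
  have h₂ := exp_neg_integral_mem_Icc (Real.sqrt_nonneg (1 + ((k : ℝ) * (l : ℝ)) ^ 2)) one_pos
    hkℝ hD (by simpa using hsqrt) η ht
  have h₃ := exp_neg_integral_mem_Icc (mul_nonneg hb.le (sq_nonneg (k : ℝ))) hb hkℝ hD
    (by rw [mul_assoc]; gcongr) η ht
  simp only [one_pow, one_mul, hDsq, Set.mem_Icc] at h₁ h₂ h₃
  simp only [M1, M2, M3, if_neg hk, hbsq]
  exact ⟨h₁, h₂, h₃⟩
end
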